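/- The symmetric group Sym(5) (the symmetric group on 5 points) has exactly 214 proper skew morphisms; that is, the number of bijections φ : Sym(5) → Sym(5) with φ(1) = 1 that admit a power function π : Sym(5) → ℕ satisfying φ(a·b) = φ(a)·φ^{π(a)}(b) for all a, b, and that are not group homomorphisms, is 214 (namely 94 whose associated skew product group has core Alt(5), plus 120 with trivial core). -/

import Mathlib

/-- A skew morphism of a group `B`: a bijection fixing `1` admitting a power
function `π` with `φ (a * b) = φ a * φ^[π a] b`. -/
def IsSkewMorphism {B : Type*} [Group B] (φ : B → B) : Prop :=
  Function.Bijective φ ∧ φ 1 = 1 ∧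
    ∃ π : B → ℕ, ∀ a b : B, φ (a * b) = φ a * φ^[π a] b

/-- A proper skew morphism: a skew morphism that is not a group homomorphism. -/
def IsProperSkewMorphism {B : Type*} [Group B] (φ : B → B) : Prop :=
  IsSkewMorphism φ ∧ ¬ (∀ a b : B, φ (a * b) = φ a * φ b)

/-- The structure of a (generalised) skew morphism: an abelian group `A` acting on `B`. -/
structure SkewData (B A : Type*) [Group B] [AddCommGroup A] where
  pw : A → Equiv.Perm B
  pw_add : ∀ i j, pw (i + j) = pw i * pw j
  pw_inj : Function.Injective pw
  pw_one : ∀ i, pw i 1 = 1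
  ps : B → A → A
  pw_mul : ∀ i a b, pw i (a * b) = pw i a * pw (ps a i) b

namespace SkewData

variable {B A : Type*} [Group B] [AddCommGroup A] (S : SkewData B A)

theorem pw_zero : S.pw 0 = 1 := by
  have h := S.pw_add 0 0
  rw [add_zero] at h
  exact (left_eq_mul.mp h)

theorem pw_neg_apply (i : A) (b : B) : S.pw (-i) (S.pw i b) = b := by
  have h := S.pw_add (-i) i
  rw [neg_add_cancel, S.pw_zero] at h
  have := congrArg (fun f => f b) h
  simpa using this.symm

theorem pw_apply_neg (i : A) (b : B) : S.pw i (S.pw (-i) b) = b := by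
  have := S.pw_neg_apply (-i) b
  rwa [neg_neg] at this

theorem pw_add_apply (i j : A) (b : B) : S.pw (i + j) b = S.pw i (S.pw j b) := by
  rw [S.pw_add]; rfl

theorem pw_ext {i j : A} (h : ∀ b, S.pw i b = S.pw j b) : i = j :=
  S.pw_inj (Equiv.ext h)

theorem ps_zero (a : B) : S.ps a 0 = 0 := by
  apply S.pw_ext
  intro b
  have h := S.pw_mul 0 a b
  rw [S.pw_zero] at h
  simp at h
  rw [← h, S.pw_zero]; rfl

theorem ps_one (i : A) : S.ps 1 i = i := by
  apply S.pw_ext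
  intro b
  have h := S.pw_mul i 1 b
  rw [one_mul, S.pw_one, one_mul] at h
  exact h.symm

theorem ps_mul (a b : B) (i : A) : S.ps (a * b) i = S.ps b (S.ps a i) := by
  apply S.pw_ext
  intro c
  have h1 := S.pw_mul i (a * b) c
  have h2 := S.pw_mul i a (b * c)
  rw [S.pw_mul _ b c, ← mul_assoc, ← mul_assoc, ← S.pw_mul i a b] at h2
  exact mul_left_cancel (h1.symm.trans h2)

theorem ps_add (a : B) (i j : A) : S.ps a (i + j) = S.ps a i + S.ps (S.pw i a) j := by
  apply S.pw_ext
  intro c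
  have h1 := S.pw_mul (j + i) a c
  rw [S.pw_add_apply, S.pw_add_apply, S.pw_mul i a c, S.pw_mul j] at h1
  have h2 := mul_left_cancel h1
  rw [← S.pw_add_apply] at h2
  rw [add_comm i j, add_comm (S.ps a i)]
  exact h2.symm

theorem ps_inv_ps (a : B) (i : A) : S.ps a⁻¹ (S.ps a i) = i := by
  rw [← S.ps_mul, mul_inv_cancel, S.ps_one]

theorem ps_ps_inv (a : B) (i : A) : S.ps a (S.ps a⁻¹ i) = i := by
  rw [← S.ps_mul, inv_mul_cancel, S.ps_one]

theorem ps_injective (a : B) : Function.Injective (S.ps a) :=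
  Function.LeftInverse.injective (S.ps_inv_ps a)

theorem ps_eq_zero {a : B} {i : A} : S.ps a i = 0 ↔ i = 0 := by
  constructor
  · intro h
    exact S.ps_injective a (h.trans (S.ps_zero a).symm)
  · rintro rfl; exact S.ps_zero a

theorem pw_inv (i : A) (a : B) : (S.pw i a)⁻¹ = S.pw (S.ps a i) a⁻¹ := by
  have h := S.pw_mul i a a⁻¹
  rw [mul_inv_cancel, S.pw_one] at h
  exact inv_eq_of_mul_eq_one_right h.symm

/-- `ps` as a left action. -/
def act : B →* Equiv.Perm A where
  toFun b := ⟨S.ps b⁻¹, S.ps b, S.ps_ps_inv b, S.ps_inv_ps b⟩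
  map_one' := by ext i; simp [S.ps_one]
  map_mul' a b := by ext i; simp [S.ps_mul]

theorem act_apply (b : B) (i : A) : S.act b i = S.ps b⁻¹ i := rfl

/-- Invariance of a subgroup. -/
def Inv (D : AddSubgroup A) : Prop := ∀ b, ∀ d ∈ D, S.ps b d ∈ D

/-- Restriction to an invariant subgroup. -/
def restrict (D : AddSubgroup A) (hD : S.Inv D) : SkewData B D where
  pw i := S.pw i
  pw_add i j := S.pw_add i j
  pw_inj := S.pw_inj.comp Subtype.val_injective
  pw_one i := S.pw_one i
  ps b i := ⟨S.ps b i, hD b i i.2⟩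
  pw_mul i a b := S.pw_mul i a b

/-- Transport along an additive isomorphism. -/
def transport {A' : Type*} [AddCommGroup A'] (e : A' ≃+ A) : SkewData B A' where
  pw i := S.pw (e i)
  pw_add i j := by rw [map_add, S.pw_add]
  pw_inj := S.pw_inj.comp e.injective
  pw_one i := S.pw_one _
  ps b i := e.symm (S.ps b (e i))
  pw_mul i a b := by rw [S.pw_mul, e.apply_symm_apply]

/-- The subgroup acting trivially modulo `D`. -/
def modKer (D : AddSubgroup A) (_hD : S.Inv D) : Subgroup B where
  carrier := {c | ∀ i, S.ps c i - i ∈ D}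
  one_mem' := by intro i; simp [S.ps_one]
  mul_mem' := by
    intro a b ha hb i
    have := D.add_mem (hb (S.ps a i)) (ha i)
    rw [S.ps_mul]; simpa using this
  inv_mem' := by
    intro a ha i
    have := D.neg_mem (ha (S.ps a⁻¹ i))
    rw [S.ps_ps_inv] at this; simpa using this

theorem ps_add_sub (D : AddSubgroup A) (hD : S.Inv D) (b : B) (i d : A) (hd : d ∈ D) :
    S.ps b (i + d) - S.ps b i ∈ D := by
  rw [S.ps_add, add_sub_cancel_left]; exact hD _ _ hd

theorem modKer_normal (D : AddSubgroup A) (hD : S.Inv D) : (S.modKer D hD).Normal := by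
  constructor
  intro c hc g i
  rw [S.ps_mul, S.ps_mul]
  have h1 := hc (S.ps g i)
  have h2 := S.ps_add_sub D hD g⁻¹ (S.ps g i) _ h1
  rw [add_sub_cancel, S.ps_inv_ps] at h2
  exact h2

theorem mem_modKer (D : AddSubgroup A) (hD : S.Inv D) (c : B) :
    c ∈ S.modKer D hD ↔ ∀ i, S.ps c i - i ∈ D := Iff.rfl

theorem inv_mul_pw_mem (D : AddSubgroup A) (hD : S.Inv D) (d : A) (hd : d ∈ D) (b : B) :
    b⁻¹ * S.pw d b ∈ S.modKer D hD := by
  intro j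
  rw [S.ps_mul]
  have h1 := S.ps_add_sub D hD b (S.ps b⁻¹ j) d hd
  rw [add_comm, S.ps_add, S.ps_ps_inv] at h1
  have h2 := D.sub_mem h1 (hD b d hd)
  convert h2 using 1
  abel

theorem modKer_ne_bot (D : AddSubgroup A) (hD : S.Inv D) (hne : D ≠ ⊥) :
    S.modKer D hD ≠ ⊥ := by
  obtain ⟨⟨d, hd⟩, hd0'⟩ := AddSubgroup.ne_bot_iff_exists_ne_zero.mp hne
  have hd0 : d ≠ 0 := fun h => hd0' (Subtype.ext h)
  intro hbot
  apply hd0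
  apply S.pw_ext
  intro b
  have h := S.inv_mul_pw_mem D hD d hd b
  rw [hbot, Subgroup.mem_bot] at h
  rw [S.pw_zero]
  exact (inv_mul_eq_one.mp h).symm

theorem inv_bot : S.Inv ⊥ := by
  intro b d hd
  rw [AddSubgroup.mem_bot] at *
  rw [hd, S.ps_zero]

end SkewData

/-- Skew data from a skew morphism. -/
theorem IsSkewMorphism.exists_data {B : Type*} [Group B] [Finite B] {φ : B → B}
    (h : IsSkewMorphism φ) :
    ∃ (n : ℕ) (_ : NeZero n) (S : SkewData B (ZMod n)), ∀ b, S.pw 1 b = φ b := by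
  obtain ⟨hb, h1, π, hπ⟩ := h
  let f : Equiv.Perm B := Equiv.ofBijective φ hb
  have hf : ∀ b, f b = φ b := fun b => rfl
  have hfit : ∀ k b, φ^[k] b = (f ^ k) b := by
    intro k b
    rw [← Equiv.Perm.iterate_eq_pow]; rfl
  have hfpos : 0 < orderOf f := orderOf_pos f
  refine ⟨orderOf f, ⟨hfpos.ne'⟩, ?_⟩
  have : NeZero (orderOf f) := ⟨hfpos.ne'⟩
  have key : ∀ (i : ℕ) (a : B), ∃ k : ℕ, ∀ b, (f ^ i) (a * b) = (f ^ i) a * (f ^ k) b := by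
    intro i
    induction i with
    | zero => intro a; exact ⟨0, fun b => by simp⟩
    | succ i ih =>
      intro a
      obtain ⟨k, hk⟩ := ih (f a)
      refine ⟨k + π a, fun b => ?_⟩
      rw [pow_succ, Equiv.Perm.mul_apply, Equiv.Perm.mul_apply, hf (a * b), hπ, hfit, ← hf, hk,
        pow_add, Equiv.Perm.mul_apply]
  have key1 : ∀ k : ℕ, (f ^ k) 1 = 1 := by
    intro k
    induction k with
    | zero => simp
    | succ k ih => rw [pow_succ, Equiv.Perm.mul_apply, hf, h1, ih]
  choose σ hσ using key
  refine ⟨⟨fun i => f ^ i.val, ?_, ?_, ?_, fun a i => (σ i.val a : ZMod (orderOf f)), ?_⟩, ?_⟩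
  · intro i j
    rw [ZMod.val_add, pow_mod_orderOf, pow_add]
  · intro i j hij
    simp only at hij
    rw [pow_inj_mod, Nat.mod_eq_of_lt (ZMod.val_lt i), Nat.mod_eq_of_lt (ZMod.val_lt j)] at hij
    exact ZMod.val_injective _ hij
  · intro i; exact key1 _
  · intro i a b
    rw [hσ, ZMod.val_natCast, pow_mod_orderOf]
  · intro b
    simp only
    rw [ZMod.val_one_eq_one_mod, pow_mod_orderOf, pow_one, hf]

/-- The symmetric group on five points. -/
abbrev S5 := Equiv.Perm (Fin 5)

/-- The alternating group on five points. -/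
abbrev A5 : Subgroup S5 := alternatingGroup (Fin 5)

namespace S5
open Equiv.Perm

theorem order_le (s : S5) : orderOf s ≤ 6 := by
  have h : ∀ s : S5, s ^ 4 = 1 ∨ s ^ 5 = 1 ∨ s ^ 6 = 1 := by decide +kernel
  rcases h s with h | h | h
  · have := Nat.le_of_dvd (by norm_num) (orderOf_dvd_of_pow_eq_one h); omega
  · have := Nat.le_of_dvd (by norm_num) (orderOf_dvd_of_pow_eq_one h); omega
  · have := Nat.le_of_dvd (by norm_num) (orderOf_dvd_of_pow_eq_one h); omega

theorem card_sq : Fintype.card {s : S5 // s * s ≠ 1} = 94 := by decide +kernel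

theorem card_eq : Fintype.card S5 = 120 := by decide +kernel

/-- First generator of the alternating group. -/
def x0 : S5 := Equiv.swap 0 1 * Equiv.swap 2 3
/-- Second generator of the alternating group. -/
def y0 : S5 := Equiv.swap 0 2 * Equiv.swap 2 4

theorem conj_x0 : ∀ x : S5, x * x = 1 → x ≠ 1 → sign x = 1 → ∃ s, s * x0 * s⁻¹ = x := by
  decide +kernel

theorem conj_y0 : ∀ y : S5, y * y * y = 1 → y ≠ 1 → (x0 * y) ^ 5 = 1 →
    ∃ s, s * x0 * s⁻¹ = x0 ∧ s * y0 * s⁻¹ = y := by decide +kernel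

theorem x0_mem : x0 ∈ A5 := by rw [mem_alternatingGroup]; decide
theorem y0_mem : y0 ∈ A5 := by rw [mem_alternatingGroup]; decide

theorem centralizer_aux : ∀ z : S5, z * x0 = x0 * z → z * y0 = y0 * z → z = 1 := by
  decide +kernel

theorem centralizer {z : S5} (h : ∀ a ∈ A5, z * a = a * z) : z = 1 :=
  centralizer_aux z (h _ x0_mem) (h _ y0_mem)

theorem normal_ge (N : Subgroup S5) (hN : N.Normal) (h : N ≠ ⊥) : A5 ≤ N := by
  apply alternatingGroup_le_of_normal
  · simp
  · exact (Subgroup.nontrivial_iff_ne_bot N).mpr h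

theorem hom_trivial {M : Type*} [CommGroup M] (f : S5 → M)
    (hf : ∀ a ∈ A5, ∀ b ∈ A5, f (a * b) = f a * f b) : ∀ a ∈ A5, f a = 1 := by
  have h1 : f 1 = 1 := by
    have := hf 1 A5.one_mem 1 A5.one_mem
    rw [one_mul] at this
    exact left_eq_mul.mp this
  let F : A5 →* M := ⟨⟨fun a => f a, h1⟩, fun a b => hf a a.2 b b.2⟩
  intro a ha
  have h2 : (⟨a, ha⟩ : A5) ∈ commutator A5 := by
    rw [commutator_alternatingGroup_eq_top (by simp)]
    exact Subgroup.mem_top _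
  exact Abelianization.commutator_subset_ker F h2

theorem hom_trivial_add {M : Type*} [AddCommGroup M] (f : S5 → M)
    (hf : ∀ a ∈ A5, ∀ b ∈ A5, f (a * b) = f a + f b) : ∀ a ∈ A5, f a = 0 := by
  have := hom_trivial (fun a => Multiplicative.ofAdd (f a))
    (fun a ha b hb => by rw [hf a ha b hb, ofAdd_add])
  intro a ha
  exact Multiplicative.ofAdd.injective (this a ha)

theorem gen (H : Subgroup S5) (hx : x0 ∈ H) (hy : y0 ∈ H) : A5 ≤ H := by
  have ox : orderOf x0 = 2 := by
    apply orderOf_eq_prime <;> decide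
  have oy : orderOf y0 = 3 := by
    apply orderOf_eq_prime <;> decide
  have oz : orderOf (x0 * y0) = 5 := by
    have : Fact (Nat.Prime 5) := ⟨by norm_num⟩
    apply orderOf_eq_prime <;> decide
  let K : Subgroup A5 := H.subgroupOf A5
  have c : ∀ z : S5, z ∈ H → z ∈ A5 → orderOf z ∣ Nat.card K := by
    intro z hz hz'
    have h1 : (⟨z, hz'⟩ : A5) ∈ K := Subgroup.mem_subgroupOf.mpr hz
    have h2 := Subgroup.orderOf_dvd_natCard K h1
    rwa [← Subgroup.orderOf_coe] at h2
  have d2 := c x0 hx x0_mem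
  have d3 := c y0 hy y0_mem
  have d5 := c (x0 * y0) (H.mul_mem hx hy) (A5.mul_mem x0_mem y0_mem)
  rw [ox] at d2
  rw [oy] at d3
  rw [oz] at d5
  have hcard : Nat.card A5 = 60 := by
    have := two_mul_nat_card_alternatingGroup (α := Fin 5)
    have h2 : Nat.card S5 = 120 := by rw [Nat.card_eq_fintype_card, card_eq]
    have h3 : 2 * Nat.card A5 = Nat.card S5 := this
    omega
  have hidx := K.card_mul_index
  rw [hcard] at hidx
  have htop : K = ⊤ := by
    have hi : K.index = 1 ∨ K.index = 2 := by
      obtain ⟨q, hq⟩ : 30 ∣ Nat.card K := by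
        have h6 : 6 ∣ Nat.card K := by omega
        omega
      rw [hq] at hidx
      have : q * K.index = 2 := by nlinarith
      have h1 : K.index ∣ 2 := ⟨q, by linarith⟩
      exact (Nat.dvd_prime Nat.prime_two).mp h1
    rcases hi with hi | hi
    · exact Subgroup.index_eq_one.mp hi
    · have := Subgroup.normal_of_index_eq_two hi
      rcases this.eq_bot_or_eq_top with h | h
      · rw [h] at d2
        simp at d2
      · exact h
  intro a ha
  have : (⟨a, ha⟩ : A5) ∈ K := by rw [htop]; exact Subgroup.mem_top _
  exact Subgroup.mem_subgroupOf.mp this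

theorem conj_of_mul (f : S5 → S5) (hinj : Function.Injective f)
    (hmul : ∀ a ∈ A5, ∀ b ∈ A5, f (a * b) = f a * f b) :
    ∃ s : S5, ∀ a ∈ A5, f a = s * a * s⁻¹ := by
  have h1 : f 1 = 1 := by
    have := hmul 1 A5.one_mem 1 A5.one_mem
    rw [one_mul] at this
    exact left_eq_mul.mp this
  have hsg : ∀ a ∈ A5, sign (f a) = 1 := hom_trivial (fun a => sign (f a))
    (fun a ha b hb => by rw [hmul a ha b hb, map_mul])
  have hx1 : f x0 * f x0 = 1 := by
    rw [← hmul _ x0_mem _ x0_mem, (by decide : x0 * x0 = 1), h1]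
  have hx2 : f x0 ≠ 1 := by
    rw [← h1]; intro h; exact absurd (hinj h) (by decide)
  obtain ⟨r, hr⟩ := conj_x0 (f x0) hx1 hx2 (hsg _ x0_mem)
  have hy1 : f y0 * f y0 * f y0 = 1 := by
    rw [← hmul _ y0_mem _ y0_mem, ← hmul _ (A5.mul_mem y0_mem y0_mem) _ y0_mem,
      (by decide : y0 * y0 * y0 = 1), h1]
  have hy2 : f y0 ≠ 1 := by
    rw [← h1]; intro h; exact absurd (hinj h) (by decide)
  have hpow : ∀ a ∈ A5, ∀ n : ℕ, f (a ^ n) = f a ^ n := by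
    intro a ha n
    induction n with
    | zero => simpa using h1
    | succ n ih => rw [pow_succ, hmul _ (A5.pow_mem ha n) _ ha, ih, pow_succ]
  have hz : (f x0 * f y0) ^ 5 = 1 := by
    rw [← hmul _ x0_mem _ y0_mem, ← hpow _ (A5.mul_mem x0_mem y0_mem),
      (by decide : (x0 * y0) ^ 5 = 1), h1]
  have hfx : f x0 = r * x0 * r⁻¹ := hr.symm
  obtain ⟨y, hy⟩ : ∃ y, f y0 = r * y * r⁻¹ := ⟨r⁻¹ * f y0 * r, by group⟩
  obtain ⟨s, hs1, hs2⟩ := conj_y0 y (by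
      rw [hy] at hy1
      have : r * (y * y * y) * r⁻¹ = 1 := by rw [← hy1]; group
      exact conj_eq_one_iff.mp this) (by
      rintro rfl; apply hy2; rw [hy]; group) (by
      rw [hy, hfx] at hz
      have e : r * x0 * r⁻¹ * (r * y * r⁻¹) = r * (x0 * y) * r⁻¹ := by group
      rw [e, conj_pow] at hz
      exact conj_eq_one_iff.mp hz)
  refine ⟨r * s, ?_⟩
  let H : Subgroup S5 :=
    { carrier := {a | a ∈ A5 ∧ f a = r * s * a * (r * s)⁻¹}
      one_mem' := ⟨A5.one_mem, by rw [h1]; group⟩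
      mul_mem' := by
        rintro a b ⟨ha, ha'⟩ ⟨hb, hb'⟩
        refine ⟨A5.mul_mem ha hb, ?_⟩
        rw [hmul a ha b hb, ha', hb']; group
      inv_mem' := by
        rintro a ⟨ha, ha'⟩
        refine ⟨A5.inv_mem ha, ?_⟩
        have := hmul a ha a⁻¹ (A5.inv_mem ha)
        rw [mul_inv_cancel, h1, ha'] at this
        rw [← inv_eq_of_mul_eq_one_right this.symm]
        group }
  have hle : A5 ≤ H := by
    apply gen
    · refine ⟨x0_mem, ?_⟩
      have : r * s * x0 * (r * s)⁻¹ = r * (s * x0 * s⁻¹) * r⁻¹ := by group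
      rw [hfx, this, hs1]
    · refine ⟨y0_mem, ?_⟩
      rw [hy, ← hs2]; group
  intro a ha
  exact (hle ha).2

/-- Injective endomorphisms of `S5` are inner. -/
theorem inner (f : S5 →* S5) (hinj : Function.Injective f) :
    ∃ s : S5, ∀ a, f a = s * a * s⁻¹ := by
  obtain ⟨s, hs⟩ := conj_of_mul f hinj (fun a _ b _ => map_mul f a b)
  refine ⟨s, fun t => ?_⟩
  have h : t⁻¹ * s⁻¹ * f t * s = 1 := by
    apply centralizer
    intro a ha
    have h1 := hs (t * a * t⁻¹) ((inferInstance : A5.Normal).conj_mem a ha t)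
    rw [map_mul, map_mul, hs a ha, map_inv] at h1
    have h2 : f t * (s * a * s⁻¹) = s * (t * a * t⁻¹) * s⁻¹ * f t := by
      rw [← h1]; group
    have h3 : t⁻¹ * s⁻¹ * f t * s * a = t⁻¹ * s⁻¹ * (f t * (s * a * s⁻¹)) * s := by group
    rw [h3, h2]; group
  have h4 : f t = s * t * (t⁻¹ * s⁻¹ * f t * s) * s⁻¹ := by group
  rw [h4, h]; group

end S5

namespace SkewData
open Equiv.Perm
variable {A : Type*} [AddCommGroup A] (S : SkewData S5 A)

/-- `A5` acts trivially. -/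
def Triv : Prop := ∀ a ∈ A5, ∀ i, S.ps a i = i

theorem A5_le_modKer (D : AddSubgroup A) (hD : S.Inv D) (hne : D ≠ ⊥) :
    ∀ a ∈ A5, ∀ i, S.ps a i - i ∈ D :=
  fun _ ha => S5.normal_ge _ (S.modKer_normal D hD) (S.modKer_ne_bot D hD hne) ha

/-- If not trivial, the action is faithful. -/
theorem faithful (h : ¬ S.Triv) {b : S5} (hb : ∀ i, S.ps b i = i) : b = 1 := by
  by_contra hb1
  apply h
  have hmem : b ∈ S.modKer ⊥ S.inv_bot := by
    intro i; rw [hb]; simp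
  have := S5.normal_ge _ (S.modKer_normal ⊥ S.inv_bot) (by
    intro h0
    rw [h0] at hmem
    exact hb1 (Subgroup.mem_bot.mp hmem))
  intro a ha i
  have h2 := this ha i
  rw [AddSubgroup.mem_bot, sub_eq_zero] at h2
  exact h2

/-- Lemma F. -/
theorem triv_of_fixed (D : AddSubgroup A) (hD : S.Inv D) (hne : D ≠ ⊥)
    (hfix : ∀ a ∈ A5, ∀ d ∈ D, S.ps a d = d) : S.Triv := by
  have hJ := S.A5_le_modKer D hD hne
  have h1 : ∀ d ∈ D, ∀ a ∈ A5, S.pw d a ∈ A5 := by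
    intro d hd a ha
    rw [mem_alternatingGroup]
    refine S5.hom_trivial (fun a => sign (S.pw d a)) ?_ a ha
    intro a ha b hb
    rw [S.pw_mul, hfix a ha d hd, map_mul]
  have h2 : ∀ d ∈ D, ∀ x, sign (S.pw d x) = sign x := by
    intro d hd x
    by_cases hx : x ∈ A5
    · rw [mem_alternatingGroup.mp (h1 d hd x hx), mem_alternatingGroup.mp hx]
    · have hx' : S.pw d x ∉ A5 := by
        intro h
        apply hx
        have := h1 (-d) (D.neg_mem hd) _ h
        rwa [S.pw_neg_apply] at this
      rw [mem_alternatingGroup] at hx hx'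
      rw [(Int.units_eq_one_or _).resolve_left hx, (Int.units_eq_one_or _).resolve_left hx']
  have h3 : ∀ i, ∀ a ∈ A5, S.pw i a ∈ A5 := by
    intro i a ha
    rw [mem_alternatingGroup]
    refine S5.hom_trivial (fun a => sign (S.pw i a)) ?_ a ha
    intro a ha b hb
    have e : S.ps a i = (S.ps a i - i) + i := by abel
    rw [S.pw_mul, map_mul, e, S.pw_add_apply, h2 _ (hJ a ha i)]
  intro a ha i
  have := S5.hom_trivial_add (fun a => S.ps a i - i) (by
    intro a ha b hb
    have e : S.ps a i = i + (S.ps a i - i) := by abel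
    rw [S.ps_mul]
    conv_lhs => rw [e]
    rw [S.ps_add, hfix _ (h3 i b hb) _ (hJ a ha i)]
    abel) a ha
  exact sub_eq_zero.mp this

end SkewData

open Equiv.Perm

/-- The skew morphisms with core `A5`. -/
def skewF (s : S5) (b : S5) : S5 := if sign b = 1 then s * b * s⁻¹ else s * b * s

theorem sign_sq (s : S5) : sign s * sign s = 1 := by
  rcases Int.units_eq_one_or (sign s) with h | h <;> rw [h] <;> rfl

theorem sign_cj (s b : S5) : sign (s * b * s⁻¹) = sign b := by
  rw [map_mul, map_mul, map_inv, mul_right_comm, mul_inv_cancel, one_mul]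

theorem sign_cj' (s b : S5) : sign (s⁻¹ * b * s) = sign b := by
  rw [map_mul, map_mul, map_inv, mul_right_comm, inv_mul_cancel, one_mul]

theorem sign_skewF (s b : S5) : sign (skewF s b) = sign b := by
  unfold skewF
  split_ifs
  · exact sign_cj s b
  · rw [map_mul, map_mul, mul_right_comm, sign_sq, one_mul]

theorem skewF_comp (s r b : S5) (h : s * r = r * s) :
    skewF s (skewF r b) = skewF (s * r) b := by
  have e : skewF s (skewF r b) = if sign (skewF r b) = 1 then s * skewF r b * s⁻¹
    else s * skewF r b * s := rfl
  rw [e, sign_skewF]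
  unfold skewF
  split_ifs
  · group
  · rw [h]
    have : s * (r * b * r) * s = s * r * b * (r * s) := by group
    rw [this, h]

theorem skewF_one (b : S5) : skewF 1 b = b := by
  unfold skewF; simp

theorem skewF_iterate (s : S5) (k : ℕ) (b : S5) : (skewF s)^[k] b = skewF (s ^ k) b := by
  induction k with
  | zero => simp [skewF_one]
  | succ k ih =>
    rw [Function.iterate_succ_apply', ih, skewF_comp _ _ _ (Commute.self_pow s k).eq, ← pow_succ']

theorem skewF_isSkew (s : S5) : IsSkewMorphism (skewF s) := by
  refine ⟨?_, ?_, fun a => if sign a = 1 then 1 else orderOf s - 1, ?_⟩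
  · apply Function.bijective_iff_has_inverse.mpr
    refine ⟨skewF s⁻¹, fun b => ?_, fun b => ?_⟩
    · rw [skewF_comp _ _ _ (by group), inv_mul_cancel, skewF_one]
    · rw [skewF_comp _ _ _ (by group), mul_inv_cancel, skewF_one]
  · simp [skewF]
  · intro a b
    have hs : s ^ (orderOf s - 1) = s⁻¹ := by
      rw [pow_sub s (orderOf_pos s), pow_orderOf_eq_one, pow_one, one_mul]
    rw [skewF_iterate]
    by_cases ha : sign a = 1
    · simp only [if_pos ha]; rw [pow_one]
      unfold skewF
      rw [map_mul, ha, one_mul, if_pos rfl]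
      split_ifs <;> group
    · simp only [if_neg ha]; rw [hs]
      unfold skewF
      have ha' := (Int.units_eq_one_or _).resolve_left ha
      rw [map_mul, ha']
      by_cases hb : sign b = 1
      · rw [hb, if_neg (by decide), if_neg (by decide), if_pos rfl]; group
      · have hb' := (Int.units_eq_one_or _).resolve_left hb
        rw [hb', if_pos (by decide), if_neg (by decide), if_neg (by decide)]; group

theorem skewF_inj : Function.Injective skewF := by
  intro s r h
  have : r⁻¹ * s = 1 := by
    apply S5.centralizer
    intro a ha
    have h1 := congrFun h a
    unfold skewF at h1
    rw [mem_alternatingGroup.mp ha, if_pos rfl, if_pos rfl] at h1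
    have h2 : s * a * s⁻¹ * s = r * a * r⁻¹ * s := by rw [h1]
    have h3 : s * a = r * a * r⁻¹ * s := by rw [← h2]; group
    rw [mul_assoc, h3]; group
  exact (inv_mul_eq_one.mp this).symm

theorem exists_odd : ∃ t : S5, sign t = -1 := ⟨Equiv.swap 0 1, by decide⟩

theorem skewF_hom_iff (s : S5) : (∀ a b, skewF s (a * b) = skewF s a * skewF s b) ↔ s * s = 1 := by
  constructor
  · intro h
    obtain ⟨t, ht⟩ := exists_odd
    apply S5.centralizer
    intro a ha
    have h1 := h t a
    unfold skewF at h1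
    rw [map_mul, ht, mem_alternatingGroup.mp ha, if_neg (by decide), if_neg (by decide),
      if_pos rfl] at h1
    have h3 : a * s = s * s * a * s⁻¹ := by
      have : a * s = (s * t)⁻¹ * (s * (t * a) * s) := by group
      rw [this, h1]; group
    have : a * (s * s) = s * s * a * s⁻¹ * s := by rw [← h3]; group
    rw [this]; group
  · intro h
    have hs : s⁻¹ = s := inv_eq_of_mul_eq_one_right h
    have : ∀ b, skewF s b = s * b * s⁻¹ := by
      intro b; unfold skewF; rw [hs]; simp
    intro a b
    rw [this, this, this]; group

theorem skewF_proper (s : S5) : IsProperSkewMorphism (skewF s) ↔ s * s ≠ 1 := by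
  unfold IsProperSkewMorphism
  rw [skewF_hom_iff]
  exact ⟨fun h => h.2, fun h => ⟨skewF_isSkew s, h⟩⟩

/-- Case 1: `A5` acts trivially. -/
theorem SkewData.triv_case {n : ℕ} [NeZero n] (S : SkewData S5 (ZMod n)) (h : S.Triv)
    (hp : ¬ ∀ a b, S.pw 1 (a * b) = S.pw 1 a * S.pw 1 b) :
    ∃ s : S5, s * s ≠ 1 ∧ ∀ b, S.pw 1 b = skewF s b := by
  obtain ⟨s, hs⟩ := S5.conj_of_mul (S.pw 1) (S.pw 1).injective (by
    intro a ha b _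
    rw [S.pw_mul, h a ha])
  have hmemc : ∀ (s a : S5), a ∈ A5 → s * a * s⁻¹ ∈ A5 := fun s a ha =>
    (inferInstance : A5.Normal).conj_mem a ha s
  have hs' : ∀ (k : ℕ), ∀ a ∈ A5, S.pw (k : ZMod n) a = s ^ k * a * (s ^ k)⁻¹ := by
    intro k
    induction k with
    | zero => intro a _; simp [S.pw_zero]
    | succ k ih =>
      intro a ha
      rw [Nat.cast_succ, S.pw_add_apply, hs a ha, ih _ (hmemc _ _ ha), pow_succ]; group
  obtain ⟨t0, ht0⟩ := exists_odd
  obtain ⟨k, hk⟩ : ∃ k : ℕ, S.ps t0 1 = (k : ZMod n) := ⟨(S.ps t0 1).val, by simp⟩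
  have hodd : ∀ t, sign t = -1 → S.ps t 1 = (k : ZMod n) := by
    intro t ht
    have h1 : t0⁻¹ * t ∈ A5 := by
      rw [mem_alternatingGroup, map_mul, map_inv, ht0, ht]; rfl
    have h2 : t = t0 * (t0⁻¹ * t) := by group
    rw [h2, S.ps_mul, h _ h1, hk]
  have hφ : ∀ t, sign t = -1 → S.pw 1 t = s * t * (s ^ k)⁻¹ := by
    intro t ht
    have hz : t⁻¹ * s⁻¹ * S.pw 1 t * s ^ k = 1 := by
      apply S5.centralizer
      intro a ha
      have e1 := S.pw_mul 1 (t * a * t⁻¹) t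
      rw [h _ (hmemc _ _ ha), hs _ (hmemc _ _ ha), inv_mul_cancel_right, S.pw_mul, hodd t ht,
        hs' k a ha] at e1
      have e2 : t⁻¹ * s⁻¹ * S.pw 1 t * s ^ k * a =
        t⁻¹ * s⁻¹ * (S.pw 1 t * (s ^ k * a * (s ^ k)⁻¹)) * s ^ k := by group
      rw [e2, e1]; group
    have h4 : S.pw 1 t = s * t * (t⁻¹ * s⁻¹ * S.pw 1 t * s ^ k) * (s ^ k)⁻¹ := by group
    rw [h4, hz, mul_one]
  -- parity is preserved
  have hpar : ∀ t, sign t = -1 → sign (S.pw 1 t) = -1 := by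
    intro t ht
    by_contra hne
    have h1 : S.pw 1 t ∈ A5 := by
      rw [mem_alternatingGroup]
      exact (Int.units_eq_one_or _).resolve_right hne
    have h2 : S.pw 1 (s⁻¹ * S.pw 1 t * s) = S.pw 1 t := by
      have := hmemc s⁻¹ _ h1
      rw [inv_inv] at this
      rw [hs _ this]; group
    have h3 := (S.pw 1).injective h2
    have h4 : sign t = 1 := by
      rw [← h3, map_mul, map_mul, mem_alternatingGroup.mp h1, map_inv]; simp
    rw [h4] at ht
    exact absurd ht (by decide)
  have hφk : ∀ (j : ℕ) (t), sign t = -1 →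
      S.pw (j : ZMod n) t = s ^ j * t * (s ^ (j * k))⁻¹ := by
    intro j
    induction j with
    | zero => intro t _; simp [S.pw_zero]
    | succ j ih =>
      intro t ht
      rw [Nat.cast_succ, S.pw_add_apply, ih _ (hpar t ht), hφ t ht, pow_succ, add_mul, one_mul,
        add_comm (j * k), pow_add]
      group
  have hkk : s ^ (k * k) = s := by
    have e := S.pw_mul 1 t0 t0⁻¹
    have ht0' : sign t0⁻¹ = -1 := by rw [map_inv, ht0]; rfl
    rw [mul_inv_cancel, S.pw_one, hφ t0 ht0, hodd t0 ht0, hφk k _ ht0'] at e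
    have e2 : s * t0 * (s ^ k)⁻¹ * (s ^ k * t0⁻¹ * (s ^ (k * k))⁻¹) = s * (s ^ (k * k))⁻¹ := by
      group
    rw [e2] at e
    exact (mul_inv_eq_one.mp e.symm).symm
  have hcases : s ^ k = s ∨ s ^ k = s⁻¹ := by
    have hle := S5.order_le s
    have hpos := orderOf_pos s
    have h1 : k * k ≡ 1 [MOD orderOf s] := by
      rw [← pow_eq_pow_iff_modEq, hkk, pow_one]
    have h2 : k ≡ 1 [MOD orderOf s] ∨ k + 1 ≡ 0 [MOD orderOf s] := by
      generalize orderOf s = d at h1 hle hpos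
      have hkd : k % d < d := Nat.mod_lt _ hpos
      unfold Nat.ModEq at *
      rw [Nat.mul_mod] at h1
      rw [Nat.add_mod]
      generalize k % d = m at *
      interval_cases d <;> interval_cases m <;> simp_all
    rcases h2 with h2 | h2
    · left
      conv_rhs => rw [← pow_one s]
      exact pow_eq_pow_iff_modEq.mpr h2
    · right
      have := (pow_eq_pow_iff_modEq (x := s)).mpr h2
      rw [pow_zero, pow_succ] at this
      exact eq_inv_of_mul_eq_one_left this
  rcases hcases with hc | hc
  · exfalso
    apply hp
    have : ∀ b, S.pw 1 b = s * b * s⁻¹ := by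
      intro b
      rcases Int.units_eq_one_or (sign b) with hb | hb
      · exact hs b (mem_alternatingGroup.mpr hb)
      · rw [hφ b hb, hc]
    intro a b
    rw [this, this, this]; group
  · have : ∀ b, S.pw 1 b = skewF s b := by
      intro b
      unfold skewF
      rcases Int.units_eq_one_or (sign b) with hb | hb
      · rw [hs b (mem_alternatingGroup.mpr hb), if_pos hb]
      · rw [hφ b hb, hc, if_neg (by rw [hb]; decide), inv_inv]
    refine ⟨s, ?_, this⟩
    rw [Ne, ← skewF_hom_iff]
    intro hh
    apply hp
    intro a b
    rw [this, this, this, hh]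

/-- Extension to six points. -/
def ext6 (e : S5) : Equiv.Perm (Fin 6) := decomposeFin.symm (0, e)
/-- Restriction to five points. -/
def res5 (p : Equiv.Perm (Fin 6)) : S5 := (decomposeFin p).2

theorem ext6_zero (e : S5) : ext6 e 0 = 0 := by simp [ext6]
theorem ext6_succ (e : S5) (i : Fin 5) : ext6 e i.succ = (e i).succ := by simp [ext6]
theorem res5_ext6 (e : S5) : res5 (ext6 e) = e := by simp [ext6, res5]
theorem ext6_res5 (p : Equiv.Perm (Fin 6)) (h : p 0 = 0) : ext6 (res5 p) = p := by
  have h1 : decomposeFin p = (0, res5 p) := by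
    have h2 : (decomposeFin.symm (decomposeFin p)) 0 = (decomposeFin p).1 := by
      obtain ⟨a, b⟩ := decomposeFin p
      simp
    rw [Equiv.symm_apply_apply, h] at h2
    unfold res5
    rw [h2]
  unfold ext6
  rw [← h1, Equiv.symm_apply_apply]
theorem ext6_mul (e f : S5) : ext6 (e * f) = ext6 e * ext6 f := by
  ext i
  refine Fin.cases ?_ (fun j => ?_) i
  · simp [ext6_zero]
  · simp [ext6_succ]
theorem ext6_one : ext6 1 = 1 := by
  ext i
  refine Fin.cases ?_ (fun j => ?_) i
  · simp [ext6_zero]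
  · simp [ext6_succ]
theorem ext6_inj : Function.Injective ext6 := Function.LeftInverse.injective res5_ext6
theorem res5_mul (p q : Equiv.Perm (Fin 6)) (hp : p 0 = 0) (hq : q 0 = 0) :
    res5 (p * q) = res5 p * res5 q := by
  apply ext6_inj
  rw [ext6_mul, ext6_res5 _ hp, ext6_res5 _ hq, ext6_res5]
  simp [hp, hq]

/-- The shifted permutation. -/
def shift6 (p : Equiv.Perm (Fin 6)) (i : Fin 6) : Equiv.Perm (Fin 6) :=
  (Equiv.addLeft i).trans (p.trans (Equiv.addLeft (-p i)))

theorem shift6_apply (p : Equiv.Perm (Fin 6)) (i j : Fin 6) :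
    shift6 p i j = - p i + p (i + j) := rfl
theorem shift6_fix (p : Equiv.Perm (Fin 6)) (i : Fin 6) : shift6 p i 0 = 0 := by
  rw [shift6_apply, add_zero, neg_add_cancel]
theorem shift6_shift6 (p : Equiv.Perm (Fin 6)) (i j : Fin 6) :
    shift6 (shift6 p i) j = shift6 p (i + j) := by
  ext1 k
  simp only [shift6_apply]
  rw [add_assoc]; abel
theorem shift6_zero (p : Equiv.Perm (Fin 6)) (h : p 0 = 0) : shift6 p 0 = p := by
  ext1 k
  simp only [shift6_apply]
  rw [h]; simp

/-- The base exceptional skew morphism powers, as functions. -/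
def base6 (i : Fin 6) (b : S5) : S5 := (res5 (shift6 (ext6 b⁻¹) i))⁻¹

theorem ext6_base6 (i : Fin 6) (b : S5) : ext6 (base6 i b)⁻¹ = shift6 (ext6 b⁻¹) i := by
  unfold base6
  rw [inv_inv, ext6_res5 _ (shift6_fix _ _)]

theorem ext6_inv_inj {a b : S5} (h : ext6 a⁻¹ = ext6 b⁻¹) : a = b :=
  inv_injective (ext6_inj h)

theorem base6_add (i j : Fin 6) (b : S5) : base6 (i + j) b = base6 i (base6 j b) := by
  apply ext6_inv_inj
  rw [ext6_base6, ext6_base6, ext6_base6, shift6_shift6, add_comm]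

theorem base6_zero (b : S5) : base6 0 b = b := by
  apply ext6_inv_inj
  rw [ext6_base6, shift6_zero _ (ext6_zero _)]

theorem base6_one (i : Fin 6) : base6 i 1 = 1 := by
  apply ext6_inv_inj
  rw [ext6_base6, inv_one, ext6_one]
  ext1 k
  simp [shift6_apply]

theorem base6_mul (i : Fin 6) (a b : S5) :
    base6 i (a * b) = base6 i a * base6 (ext6 a⁻¹ i) b := by
  apply ext6_inv_inj
  rw [mul_inv_rev, ext6_mul, ext6_base6, ext6_base6, ext6_base6, mul_inv_rev, ext6_mul]
  ext1 k
  simp only [shift6_apply, mul_apply]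
  rw [add_neg_cancel_left]

/-- The base exceptional skew morphism. -/
def phi0 (b : S5) : S5 := base6 1 b

theorem phi0_iterate (k : ℕ) (b : S5) : phi0^[k] b = base6 (Fin.ofNat 6 k) b := by
  induction k with
  | zero => exact (base6_zero b).symm
  | succ k ih =>
    have : Fin.ofNat 6 (k + 1) = 1 + Fin.ofNat 6 k := by
      ext; simp [Fin.val_add, add_comm]
    rw [Function.iterate_succ_apply', ih, this, base6_add]; rfl

theorem phi0_isSkew : IsSkewMorphism phi0 := by
  refine ⟨?_, base6_one 1, fun a => (ext6 a⁻¹ 1).val, ?_⟩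
  · apply Function.bijective_iff_has_inverse.mpr
    refine ⟨base6 (-1), fun b => ?_, fun b => ?_⟩
    · unfold phi0; rw [← base6_add, neg_add_cancel, base6_zero]
    · unfold phi0; rw [← base6_add, add_neg_cancel, base6_zero]
  · intro a b
    rw [phi0_iterate, Fin.ofNat_val_eq_self]
    exact base6_mul 1 a b

/-- The conjugates of the base exceptional skew morphism. -/
def skewG (g : S5) (b : S5) : S5 := g⁻¹ * phi0 (g * b * g⁻¹) * g

theorem skewG_iterate (g : S5) (k : ℕ) (b : S5) :
    (skewG g)^[k] b = g⁻¹ * phi0^[k] (g * b * g⁻¹) * g := by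
  induction k with
  | zero => simp; group
  | succ k ih =>
    rw [Function.iterate_succ_apply', Function.iterate_succ_apply', ih]
    unfold skewG
    congr 3
    group

theorem skewG_isSkew (g : S5) : IsSkewMorphism (skewG g) := by
  obtain ⟨hb, h1, π, hπ⟩ := phi0_isSkew
  refine ⟨?_, ?_, fun a => π (g * a * g⁻¹), ?_⟩
  · have : skewG g = (fun b => g⁻¹ * b * g) ∘ phi0 ∘ (fun b => g * b * g⁻¹) := rfl
    rw [this]
    refine Function.Bijective.comp ?_ (hb.comp ?_)
    · have := (MulAut.conj g⁻¹).bijective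
      convert this using 1
      ext1 b; simp
    · exact (MulAut.conj g).bijective
  · unfold skewG; simp [h1]
  · intro a b
    rw [skewG_iterate]
    unfold skewG
    have : g * (a * b) * g⁻¹ = (g * a * g⁻¹) * (g * b * g⁻¹) := by group
    rw [this, hπ]; group

theorem phi0_bad : ∃ a : S5, sign a = 1 ∧ sign (phi0 a) = -1 := by decide +kernel

theorem skewG_bad (g : S5) : ∃ a : S5, sign (skewG g a) ≠ sign a := by
  obtain ⟨a, h1, h2⟩ := phi0_bad
  refine ⟨g⁻¹ * a * g, ?_⟩
  unfold skewG
  have : g * (g⁻¹ * a * g) * g⁻¹ = a := by group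
  rw [this]
  rw [sign_cj', sign_cj', h1, h2]; decide

theorem skewG_proper (g : S5) : IsProperSkewMorphism (skewG g) := by
  refine ⟨skewG_isSkew g, fun h => ?_⟩
  let F : S5 →* S5 := ⟨⟨skewG g, (skewG_isSkew g).2.1⟩, h⟩
  obtain ⟨s, hs⟩ := S5.inner F (skewG_isSkew g).1.1
  obtain ⟨a, ha⟩ := skewG_bad g
  apply ha
  have : skewG g a = s * a * s⁻¹ := hs a
  rw [this, sign_cj]

theorem phi0_conj : ∀ x : S5, (∀ b, phi0 (x * b * x⁻¹) = x * phi0 b * x⁻¹) → x = 1 := by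
  intro x hx
  have hit : ∀ (k : ℕ) b, phi0^[k] (x * b * x⁻¹) = x * phi0^[k] b * x⁻¹ := by
    intro k
    induction k with
    | zero => intro b; rfl
    | succ k ih => intro b; rw [Function.iterate_succ_apply, hx, ih]; rfl
  have hit' : ∀ (k : Fin 6) b, base6 k (x * b * x⁻¹) = x * base6 k b * x⁻¹ := by
    intro k b
    have := hit k.val b
    rwa [phi0_iterate, phi0_iterate, Fin.ofNat_val_eq_self] at this
  have hfaith : ∀ i j : Fin 6, (∀ b, base6 i b = base6 j b) → i = j := by
    decide +kernel
  have hps : ∀ (a : S5) (i : Fin 6), ext6 (x * a * x⁻¹)⁻¹ i = ext6 a⁻¹ i := by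
    intro a i
    apply hfaith
    intro b
    obtain ⟨b, rfl⟩ : ∃ c, b = x * c * x⁻¹ := ⟨x⁻¹ * b * x, by group⟩
    have h1 := base6_mul i (x * a * x⁻¹) (x * b * x⁻¹)
    have e : x * a * x⁻¹ * (x * b * x⁻¹) = x * (a * b) * x⁻¹ := by group
    rw [e, hit', hit' i a, base6_mul] at h1
    have h2 : x * base6 i a * x⁻¹ * (x * base6 (ext6 a⁻¹ i) b * x⁻¹) =
      x * base6 i a * x⁻¹ * base6 (ext6 (x * a * x⁻¹)⁻¹ i) (x * b * x⁻¹) := by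
      rw [← h1]; group
    rw [hit' (ext6 a⁻¹ i)]
    exact (mul_left_cancel h2).symm
  apply S5.centralizer
  intro a _
  have := ext6_inv_inj (Equiv.ext (hps a))
  exact mul_inv_eq_iff_eq_mul.mp this

theorem skewG_inj : Function.Injective skewG := by
  intro g h hgh
  have : g * h⁻¹ = 1 := by
    apply phi0_conj
    intro b
    have h1 := congrFun hgh (h⁻¹ * b * h)
    unfold skewG at h1
    have e1 : h * (h⁻¹ * b * h) * h⁻¹ = b := by group
    have e2 : g * (h⁻¹ * b * h) * g⁻¹ = g * h⁻¹ * b * (g * h⁻¹)⁻¹ := by group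
    rw [e1, e2] at h1
    have e3 : phi0 (g * h⁻¹ * b * (g * h⁻¹)⁻¹) =
      g * (g⁻¹ * phi0 (g * h⁻¹ * b * (g * h⁻¹)⁻¹) * g) * g⁻¹ := by group
    rw [e3, h1]; group
  exact mul_inv_eq_one.mp this

/-- Case 2, six points. -/
theorem SkewData.six_case (S : SkewData S5 (ZMod 6)) (h : ¬ S.Triv) :
    ∃ g : S5, ∀ b, S.pw 1 b = skewG g b := by
  let p : S5 → Equiv.Perm (Fin 6) := fun b => S.act b
  have hp0 : ∀ b, p b 0 = 0 := fun b => S.ps_zero _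
  let F : S5 →* S5 :=
    { toFun := fun b => res5 (p b)
      map_one' := by
        apply ext6_inj
        rw [ext6_res5 _ (hp0 1), ext6_one]
        exact map_one S.act
      map_mul' := by
        intro a b
        rw [← res5_mul _ _ (hp0 a) (hp0 b)]
        congr 1
        exact map_mul S.act a b }
  have hF : ∀ b, ext6 (F b) = p b := fun b => ext6_res5 _ (hp0 b)
  have hpinj : ∀ a, p a = 1 → a = 1 := by
    intro a ha
    have : a⁻¹ = 1 := S.faithful h (fun i => congrArg (fun q => q i) ha)
    exact inv_eq_one.mp this
  have hinj : Function.Injective F := by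
    rw [injective_iff_map_eq_one]
    intro a ha
    apply hpinj
    rw [← hF, ha, ext6_one]
  obtain ⟨g, hg⟩ := S5.inner F hinj
  refine ⟨g, fun b => ?_⟩
  have key : F (S.pw 1 b)⁻¹ = (base6 1 (F b))⁻¹ := by
    apply ext6_inj
    rw [ext6_base6, hF, ← map_inv F b, hF]
    ext1 j
    rw [shift6_apply]
    have h1 := S.ps_add b 1 j
    have e1 : p (S.pw 1 b)⁻¹ j = S.ps (S.pw 1 b) j := by
      change S.ps _ _ = _
      rw [inv_inv]
    have e2 : ∀ j, p b⁻¹ j = S.ps b j := by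
      intro j
      change S.ps _ _ = _
      rw [inv_inv]
    rw [e1, e2, e2]
    exact (neg_add_eq_of_eq_add h1).symm
  rw [map_inv, inv_inj, hg, hg] at key
  unfold skewG phi0
  rw [← key]; group

theorem final_count
    (main : ∀ (n : ℕ) [NeZero n] (S : SkewData S5 (ZMod n)), ¬ S.Triv → n = 6) :
    Nat.card {φ : Equiv.Perm (Fin 5) → Equiv.Perm (Fin 5) //
      IsProperSkewMorphism φ} = 214 := by
  let T : Type := {s : S5 // s * s ≠ 1} ⊕ S5
  let f : T → {φ : Equiv.Perm (Fin 5) → Equiv.Perm (Fin 5) // IsProperSkewMorphism φ} :=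
    Sum.elim (fun s => ⟨skewF s.1, (skewF_proper s.1).mpr s.2⟩) (fun g => ⟨skewG g, skewG_proper g⟩)
  have hf : Function.Bijective f := by
    constructor
    · rintro (s | g) (s' | g') h
      · have := congrArg Subtype.val h
        congr 1
        exact Subtype.ext (skewF_inj this)
      · exfalso
        have : skewF s.1 = skewG g' := congrArg Subtype.val h
        obtain ⟨a, ha⟩ := skewG_bad g'
        rw [← this] at ha
        exact ha (sign_skewF _ _)
      · exfalso
        have : skewG g = skewF s'.1 := congrArg Subtype.val h
        obtain ⟨a, ha⟩ := skewG_bad g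
        rw [this] at ha
        exact ha (sign_skewF _ _)
      · have := congrArg Subtype.val h
        congr 1
        exact skewG_inj this
    · rintro ⟨φ, hφ⟩
      obtain ⟨n, hn, S, hS⟩ := hφ.1.exists_data
      by_cases ht : S.Triv
      · obtain ⟨s, hs, hsf⟩ := S.triv_case ht (by
          intro hh
          apply hφ.2
          intro a b
          rw [← hS, ← hS, ← hS, hh])
        refine ⟨Sum.inl ⟨s, hs⟩, Subtype.ext (funext fun b => ?_)⟩
        change skewF s b = φ b
        rw [← hS, hsf]
      · obtain rfl := main n S ht
        obtain ⟨g, hg⟩ := S.six_case ht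
        refine ⟨Sum.inr g, Subtype.ext (funext fun b => ?_)⟩
        change skewG g b = φ b
        rw [← hS, hg]
  rw [← Nat.card_congr (Equiv.ofBijective f hf), Nat.card_eq_fintype_card, Fintype.card_sum,
    S5.card_sq, S5.card_eq]

open Equiv.Perm

set_option linter.unusedSectionVars false
set_option linter.unusedDecidableInType false

namespace SkewData
variable {A : Type*} [AddCommGroup A] (S : SkewData S5 A)

theorem ps_sub (b : S5) (x y : A) : S.ps b y - S.ps b x = S.ps (S.pw x b) (y - x) := by
  have := S.ps_add b x (y - x)
  rw [add_sub_cancel] at this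
  rw [this, add_sub_cancel_left]

theorem neg_ps_neg (b : S5) (x : A) : -S.ps b (-x) = S.ps (S.pw (-x) b) x := by
  have := S.ps_add b (-x) x
  rw [neg_add_cancel, S.ps_zero] at this
  exact (eq_neg_of_add_eq_zero_right this.symm).symm

/-- Primitivity: no proper nontrivial invariant subgroup. -/
def Prim : Prop := ∀ D : AddSubgroup A, S.Inv D → D = ⊥ ∨ D = ⊤

/-- The stabilizer of a point. -/
def stab (x : A) : Subgroup S5 where
  carrier := {b | S.ps b x = x}
  one_mem' := S.ps_one x
  mul_mem' := by
    intro a b (ha : _ = _) (hb : _ = _)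
    change S.ps _ _ = _
    rw [S.ps_mul, ha, hb]
  inv_mem' := by
    intro a (ha : _ = _)
    change S.ps _ _ = _
    conv_lhs => rw [← ha]
    rw [S.ps_inv_ps]

theorem mem_stab {x : A} {b : S5} : b ∈ S.stab x ↔ S.ps b x = x := Iff.rfl

/-- Fixed points of `A5` form a subgroup. -/
def fixA : AddSubgroup A where
  carrier := {i | ∀ a ∈ A5, S.ps a i = i}
  zero_mem' := fun a _ => S.ps_zero a
  add_mem' := by
    intro i j hi hj a ha
    have h : S.pw i a ∈ A5 := by
      rw [mem_alternatingGroup]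
      refine S5.hom_trivial (fun a => sign (S.pw i a)) ?_ a ha
      intro a ha b hb
      rw [S.pw_mul, hi a ha, map_mul]
    rw [S.ps_add, hi a ha, hj _ h]
  neg_mem' := by
    intro i hi a ha
    have h : ∀ a ∈ A5, S.pw i a ∈ A5 := by
      intro a ha
      rw [mem_alternatingGroup]
      refine S5.hom_trivial (fun a => sign (S.pw i a)) ?_ a ha
      intro a ha b hb
      rw [S.pw_mul, hi a ha, map_mul]
    -- `pw i` maps `A5` onto itself
    have h2 : ∃ c ∈ A5, S.pw i c = a := by
      have hinj : Function.Injective (fun c : A5 => (⟨S.pw i c, h c c.2⟩ : A5)) := by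
        intro c d hcd
        exact Subtype.ext ((S.pw i).injective (congrArg Subtype.val hcd))
      obtain ⟨c, hc⟩ := (Finite.injective_iff_surjective.mp hinj) ⟨a, ha⟩
      exact ⟨c, c.2, congrArg Subtype.val hc⟩
    obtain ⟨c, hc, rfl⟩ := h2
    have h3 := S.ps_add c i (-i)
    rw [add_neg_cancel, S.ps_zero, hi c hc] at h3
    exact (neg_eq_of_add_eq_zero_right h3.symm).symm

theorem fixA_inv : S.Inv S.fixA := by
  intro b i hi a ha
  have : b * a = (b * a * b⁻¹) * b := by group
  rw [← S.ps_mul, this, S.ps_mul, hi _ ((inferInstance : A5.Normal).conj_mem a ha b)]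

theorem fixA_bot (hP : S.Prim) (h : ¬ S.Triv) : S.fixA = ⊥ := by
  rcases hP _ S.fixA_inv with h1 | h1
  · exact h1
  · exfalso
    apply h
    intro a ha i
    have : i ∈ S.fixA := by rw [h1]; exact AddSubgroup.mem_top i
    exact this a ha

theorem eq_zero_of_fixed (hP : S.Prim) (h : ¬ S.Triv) {x : A} (hx : ∀ a ∈ A5, S.ps a x = x) :
    x = 0 := by
  have : x ∈ S.fixA := hx
  rwa [S.fixA_bot hP h, AddSubgroup.mem_bot] at this

theorem inv_closure (X : Set A) (hX : ∀ b, ∀ x ∈ X, S.ps b x ∈ X) :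
    S.Inv (AddSubgroup.closure X) := by
  intro b d hd
  revert b
  induction hd using AddSubgroup.closure_induction with
  | mem x hx => intro b; exact AddSubgroup.subset_closure (hX b x hx)
  | zero => intro b; rw [S.ps_zero]; exact AddSubgroup.zero_mem _
  | add x y _ _ hx hy => intro b; rw [S.ps_add]; exact AddSubgroup.add_mem _ (hx b) (hy _)
  | neg x _ hx =>
    intro b
    have h1 : S.ps b (-x) = -S.ps (S.pw (-x) b) x := by rw [← S.neg_ps_neg, neg_neg]
    rw [h1]; exact AddSubgroup.neg_mem _ (hx _)

variable [Fintype A] [DecidableEq A]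

/-- The orbit of a point. -/
def orb (x : A) : Finset A := Finset.univ.image (fun b => S.ps b x)

theorem mem_orb {x y : A} : y ∈ S.orb x ↔ ∃ b, S.ps b x = y := by simp [orb]

theorem self_mem_orb (x : A) : x ∈ S.orb x := S.mem_orb.mpr ⟨1, S.ps_one x⟩

theorem ps_mem_orb {x y : A} (b : S5) : S.ps b y ∈ S.orb x ↔ y ∈ S.orb x := by
  rw [mem_orb, mem_orb]
  constructor
  · rintro ⟨c, hc⟩
    exact ⟨c * b⁻¹, by rw [S.ps_mul, hc, S.ps_inv_ps]⟩
  · rintro ⟨c, hc⟩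
    exact ⟨c * b, by rw [S.ps_mul, hc]⟩

theorem orb_eq {x y : A} (h : y ∈ S.orb x) : S.orb y = S.orb x := by
  ext z
  obtain ⟨b, rfl⟩ := S.mem_orb.mp h
  rw [mem_orb, mem_orb]
  constructor
  · rintro ⟨c, rfl⟩; exact ⟨b * c, S.ps_mul _ _ _⟩
  · rintro ⟨c, rfl⟩; exact ⟨b⁻¹ * c, by rw [S.ps_mul, S.ps_inv_ps]⟩

theorem zero_mem_orb {x : A} : 0 ∈ S.orb x ↔ x = 0 := by
  rw [mem_orb]
  constructor
  · rintro ⟨b, hb⟩; exact S.ps_eq_zero.mp hb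
  · rintro rfl; exact ⟨1, S.ps_zero _⟩

theorem card_orb_mul (x : A) : (S.orb x).card * Nat.card (S.stab x) = 120 := by
  let _ : MulAction S5 A := MulAction.compHom A S.act
  have hsm : ∀ (b : S5) (y : A), b • y = S.ps b⁻¹ y := fun b y => rfl
  let _ : Fintype (MulAction.orbit S5 x) := Fintype.ofFinite _
  let _ : Fintype (MulAction.stabilizer S5 x) := Fintype.ofFinite _
  have h := MulAction.card_orbit_mul_card_stabilizer_eq_card_group S5 x
  rw [S5.card_eq, ← Nat.card_eq_fintype_card, ← Nat.card_eq_fintype_card] at h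
  have h1 : Nat.card (MulAction.orbit S5 x) = (S.orb x).card := by
    have : MulAction.orbit S5 x = (S.orb x : Set A) := by
      ext y
      rw [Finset.mem_coe, mem_orb, MulAction.mem_orbit_iff]
      constructor
      · rintro ⟨b, hb⟩; exact ⟨b⁻¹, hb⟩
      · rintro ⟨b, hb⟩; exact ⟨b⁻¹, by rw [hsm, inv_inv, hb]⟩
    rw [this, Nat.card_coe_set_eq, Set.ncard_coe_finset]
  have h2 : MulAction.stabilizer S5 x = S.stab x := by
    ext b
    rw [MulAction.mem_stabilizer_iff, hsm, ← (S.stab x).inv_mem_iff]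
    rfl
  rw [h1, h2] at h
  exact h

theorem card_orb_dvd (x : A) : (S.orb x).card ∣ 120 := ⟨_, (S.card_orb_mul x).symm⟩

theorem card_orb_ge (hP : S.Prim) (h : ¬ S.Triv) {x : A} (hx : x ≠ 0) :
    5 ≤ (S.orb x).card := by
  by_contra hlt
  push Not at hlt
  let X := {y // y ∈ S.orb x}
  let F : S5 →* Equiv.Perm X :=
    { toFun := fun b => (S.act b).subtypePerm (fun y => S.ps_mem_orb b⁻¹)
      map_one' := by ext y; exact congrArg (fun q => q y.1) (map_one S.act)
      map_mul' := by intro a b; ext y; exact congrArg (fun q => q y.1) (map_mul S.act a b) }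
  have hF : ∀ b y, ((F b y : X) : A) = S.ps b⁻¹ y := fun b y => rfl
  by_cases hk : F.ker = ⊥
  · have hinj : Function.Injective F := (MonoidHom.ker_eq_bot_iff F).mp hk
    have hc := Fintype.card_le_of_injective F hinj
    rw [S5.card_eq, Fintype.card_perm, Fintype.card_coe] at hc
    have := Nat.factorial_le (show (S.orb x).card ≤ 4 by omega)
    rw [show Nat.factorial 4 = 24 from rfl] at this
    omega
  · have hle := S5.normal_ge F.ker inferInstance hk
    apply hx
    apply S.eq_zero_of_fixed hP h
    intro a ha
    have h1 : F a⁻¹ = 1 := hle (A5.inv_mem ha)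
    have h2 := hF a⁻¹ ⟨x, S.self_mem_orb x⟩
    rw [h1, inv_inv] at h2
    exact h2.symm

/-- Invariant functions. -/
def InvFun {R : Type*} (f : A → R) : Prop := ∀ b x, f (S.ps b x) = f x

theorem inv_conv {R : Type*} [CommRing R] {f g : A → R} (hf : S.InvFun f) (hg : S.InvFun g) :
    S.InvFun (fun y => ∑ x, f x * g (y - x)) := by
  intro b y
  have hbij : Function.Bijective (S.ps b) := (S.act b⁻¹).bijective |> fun h => by
    have e : ⇑(S.act b⁻¹) = S.ps b := by ext i; rw [S.act_apply, inv_inv]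
    rwa [e] at h
  change ∑ x, f x * g (S.ps b y - x) = ∑ x, f x * g (y - x)
  rw [← Function.Bijective.sum_comp hbij]
  apply Finset.sum_congr rfl
  intro x _
  rw [hf, S.ps_sub, hg]

end SkewData

open Equiv.Perm

set_option linter.unusedSectionVars false
set_option linter.unusedDecidableInType false

namespace SkewData
variable {A : Type*} [AddCommGroup A] (S : SkewData S5 A)
variable [Fintype A] [DecidableEq A]

/-- Invariant finite set. -/
def InvSet (X : Finset A) : Prop := ∀ b x, S.ps b x ∈ X ↔ x ∈ X

theorem orb_invSet (x : A) : S.InvSet (S.orb x) := fun b _ => S.ps_mem_orb b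

open AddMonoidAlgebra in
theorem inv_mul_alg {R : Type*} [CommRing R] (u v : AddMonoidAlgebra R A)
    (hu : S.InvFun (fun x => u.coeff x)) (hv : S.InvFun (fun x => v.coeff x)) :
    S.InvFun (fun x => (u * v).coeff x) := by
  have : (fun x => (u * v).coeff x) = fun y => ∑ x, u.coeff x * v.coeff (y - x) := by
    ext y
    rw [coeff_mul_apply_left, Finsupp.sum_fintype]
    · simp only [neg_add_eq_sub]
    · intro i; rw [zero_mul]
  rw [this]
  exact S.inv_conv hu hv

open AddMonoidAlgebra in
theorem frob (q : ℕ) (hq : q.Prime) (X : Finset A) (hX : S.InvSet X) :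
    S.InvFun (fun y => (((X.filter (fun x => q • x = y)).card : ℕ) : ZMod q)) := by
  have : Fact q.Prime := ⟨hq⟩
  let e : AddMonoidAlgebra (ZMod q) A := ∑ x ∈ X, single x 1
  have he : ∀ y, e.coeff y = if y ∈ X then 1 else 0 := by
    intro y
    simp [e, Finsupp.single_apply]
  have hinv : ∀ k : ℕ, S.InvFun (fun x => (e ^ (k + 1)).coeff x) := by
    intro k
    induction k with
    | zero =>
      intro b x
      simp only [zero_add, pow_one, he, hX b x]
    | succ k ih =>
      rw [pow_succ]
      apply S.inv_mul_alg _ _ ih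
      intro b x
      simp only [he, hX b x]
  have hchar : CharP (AddMonoidAlgebra (ZMod q) A) q :=
    charP_of_injective_algebraMap (FaithfulSMul.algebraMap_injective (ZMod q) _) q
  have hpow : e ^ q = ∑ x ∈ X, single (q • x) 1 := by
    rw [sum_pow_char]
    apply Finset.sum_congr rfl
    intro x _
    rw [single_pow, one_pow]
  obtain ⟨k, rfl⟩ : ∃ k, q = k + 1 := ⟨q - 1, by have := hq.pos; omega⟩
  have := hinv k
  rw [hpow] at this
  convert this using 2 with y
  simp [Finsupp.single_apply, Finset.sum_boole]

/-- Self-correlation. -/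
def lam (X : Finset A) (h : A) : ℕ := (X.filter (fun x => x - h ∈ X)).card

theorem neg_invSet {X : Finset A} (hX : S.InvSet X) (b : S5) (x : A) :
    -S.ps b x ∈ X ↔ -x ∈ X := by
  have := S.neg_ps_neg b (-x)
  rw [neg_neg] at this
  rw [this, hX]

theorem lam_inv {X : Finset A} (hX : S.InvSet X) (b : S5) (h : A) :
    lam X (S.ps b h) = lam X h := by
  have h1 := S.inv_conv (R := ℤ) (f := fun x => if x ∈ X then 1 else 0)
    (g := fun x => if -x ∈ X then 1 else 0)
    (by intro b x; simp only [hX b x]) (by intro b x; simp only [S.neg_invSet hX b x])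
  have h2 : ∀ h, ((lam X h : ℕ) : ℤ) =
      ∑ x, (if x ∈ X then 1 else 0) * (if -(h - x) ∈ X then (1 : ℤ) else 0) := by
    intro h
    unfold lam
    simp only [neg_sub, ite_mul, one_mul, zero_mul, Finset.sum_ite_mem, Finset.univ_inter,
      Finset.sum_boole]
  have h3 := h1 b h
  simp only at h3
  rw [← h2, ← h2] at h3
  exact_mod_cast h3

theorem sum_lam (X : Finset A) : ∑ h, lam X h = X.card * X.card := by
  unfold lam
  simp only [Finset.card_filter]
  rw [Finset.sum_comm]
  rw [Finset.sum_congr rfl (g := fun _ => X.card)]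
  · simp
  · intro x _
    rw [← Equiv.sum_comp (Equiv.subLeft x)]
    simp

theorem lam_zero (X : Finset A) : lam X 0 = X.card := by
  unfold lam
  simp

theorem sum_lam_ne (X : Finset A) :
    ∑ h ∈ Finset.univ.erase 0, lam X h + X.card = X.card * X.card := by
  rw [← sum_lam, ← lam_zero X]
  exact Finset.sum_erase_add _ _ (Finset.mem_univ 0)

/-- Transitivity on nonzero elements. -/
def Trans : Prop := ∀ x y : A, x ≠ 0 → y ≠ 0 → y ∈ S.orb x

/-- The radical of an invariant set. -/
def rad (X : Finset A) : AddSubgroup A where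
  carrier := {r | ∀ x, x + r ∈ X ↔ x ∈ X}
  zero_mem' := by intro x; simp
  add_mem' := by
    intro r s hr hs x
    rw [← add_assoc, hs, hr]
  neg_mem' := by
    intro r hr x
    rw [← hr (x + -r), neg_add_cancel_right]

theorem rad_inv {X : Finset A} (hX : S.InvSet X) : S.Inv (rad X) := by
  intro b r hr x
  let y := -S.ps b⁻¹ (-x)
  let c := S.pw (-y) b
  have h1 : S.ps c y = x := by
    have := S.neg_ps_neg b y
    rw [← this]
    simp only [y, neg_neg, S.ps_ps_inv]
  have h2 : S.pw y c = b := S.pw_apply_neg y b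
  have h3 := S.ps_add c y r
  rw [h1, h2] at h3
  rw [← h3, hX, hr, ← h1, hX]

theorem trans_of_composite (hP : S.Prim) (h : ¬ S.Triv) [IsAddCyclic A] {p : ℕ} (hp : p.Prime)
    (hdvd : p ∣ Fintype.card A) (hne : Fintype.card A ≠ p) : S.Trans := by
  let P : AddSubgroup A := (nsmulAddMonoidHom (α := A) p).ker
  have memP : ∀ x, x ∈ P ↔ p • x = 0 := fun x => Iff.rfl
  let PF : Finset A := Finset.univ.filter (fun x => p • x = 0)
  have hPF : PF.card ≤ p := IsAddCyclic.card_nsmul_eq_zero_le hp.pos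
  have hPbot : P ≠ ⊥ := by
    have : Fact p.Prime := ⟨hp⟩
    obtain ⟨x, hx⟩ := exists_prime_addOrderOf_dvd_card p hdvd
    intro hb
    have h1 : x ∈ P := by rw [memP, ← hx]; exact addOrderOf_nsmul_eq_zero x
    rw [hb, AddSubgroup.mem_bot] at h1
    rw [h1, addOrderOf_zero] at hx
    exact hp.one_lt.ne hx
  have hPtop : P ≠ ⊤ := by
    intro ht
    have h1 : PF = Finset.univ := by
      ext x
      have : x ∈ P := by rw [ht]; exact AddSubgroup.mem_top x
      simpa [PF] using (memP x).mp this
    rw [h1, Finset.card_univ] at hPF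
    have := Nat.le_of_dvd Fintype.card_pos hdvd
    omega
  have hRtop : (nsmulAddMonoidHom (α := A) p).range ≠ ⊤ := by
    intro ht
    have hs := AddMonoidHom.range_eq_top.mp ht
    have hi := Finite.injective_iff_surjective.mpr hs
    exact hPbot ((AddMonoidHom.ker_eq_bot_iff _).mpr hi)
  have hA : ∀ X : Finset A, S.InvSet X → ∀ x ∈ X, p • x ≠ 0 → ∀ r, p • r = 0 → x + r ∈ X := by
    intro X hX x hx hpx r hr
    have hfr := S.frob p hp X hX
    have hcl := S.inv_closure {y | (((X.filter (fun x => p • x = y)).card : ℕ) : ZMod p) ≠ 0}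
      (by intro b y hy
          have := hfr b y
          simp only at this
          rw [Set.mem_ofPred_eq, this]
          exact hy)
    have hle : AddSubgroup.closure
        {y | (((X.filter (fun x => p • x = y)).card : ℕ) : ZMod p) ≠ 0} ≤
        (nsmulAddMonoidHom (α := A) p).range := by
      rw [AddSubgroup.closure_le]
      intro y hy
      by_contra hn
      apply hy
      have : X.filter (fun x => p • x = y) = ∅ := by
        rw [Finset.filter_eq_empty_iff]
        intro z _ hz
        exact hn ⟨z, hz⟩
      rw [this]; simp
    have hbot := (hP _ hcl).resolve_right (fun ht => hRtop (top_le_iff.mp (ht ▸ hle)))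
    have hz : (((X.filter (fun z => p • z = p • x)).card : ℕ) : ZMod p) = 0 := by
      by_contra hn
      have : p • x ∈ AddSubgroup.closure
          {y | (((X.filter (fun x => p • x = y)).card : ℕ) : ZMod p) ≠ 0} :=
        AddSubgroup.subset_closure hn
      rw [hbot, AddSubgroup.mem_bot] at this
      exact hpx this
    rw [ZMod.natCast_eq_zero_iff] at hz
    have hpos : 0 < (X.filter (fun z => p • z = p • x)).card :=
      Finset.card_pos.mpr ⟨x, by simp [hx]⟩
    have hge := Nat.le_of_dvd hpos hz
    have hsub : X.filter (fun z => p • z = p • x) ⊆ PF.image (fun r => x + r) := by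
      intro z hz
      rw [Finset.mem_filter] at hz
      rw [Finset.mem_image]
      exact ⟨z - x, by simp [PF, smul_sub, hz.2], by abel⟩
    have heq := Finset.eq_of_subset_of_card_le hsub
      ((Finset.card_image_le.trans hPF).trans hge)
    have : x + r ∈ PF.image (fun r => x + r) :=
      Finset.mem_image.mpr ⟨r, by simp [PF, hr], rfl⟩
    rw [← heq, Finset.mem_filter] at this
    exact this.1
  have hB : ∀ x, x ≠ 0 → ∃ y ∈ S.orb x, p • y = 0 := by
    intro x hx
    by_contra hn
    push Not at hn
    have hle : P ≤ rad (S.orb x) := by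
      intro r hr z
      constructor
      · intro hz
        have := hA _ (S.orb_invSet x) _ hz (hn _ hz) (-r) (by rw [smul_neg, (memP r).mp hr, neg_zero])
        rwa [add_neg_cancel_right] at this
      · intro hz
        exact hA _ (S.orb_invSet x) _ hz (hn _ hz) r hr
    rcases hP _ (S.rad_inv (S.orb_invSet x)) with hb | ht
    · rw [hb] at hle
      exact hPbot (le_bot_iff.mp hle)
    · have h1 : -x ∈ rad (S.orb x) := by rw [ht]; exact AddSubgroup.mem_top _
      have h2 := (h1 x).mpr (S.self_mem_orb x)
      rw [add_neg_cancel, S.zero_mem_orb] at h2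
      exact hx h2
  -- no orbit of size at most half
  have hC : ∀ x, x ≠ 0 → ¬ (2 * (S.orb x).card + 1 ≤ Fintype.card A) := by
    intro x hx hle
    set X := S.orb x with hXdef
    let X1 := X.filter (fun x => p • x ≠ 0)
    let X0 := X.filter (fun x => p • x = 0)
    have hsum : X0.card + X1.card = X.card := Finset.card_filter_add_card_filter_not _
    have h0 : X0.card + 1 ≤ p := by
      have : insert 0 X0 ⊆ PF := by
        intro z hz
        rw [Finset.mem_insert] at hz
        rcases hz with rfl | hz
        · simp [PF]
        · simp only [X0, Finset.mem_filter] at hz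
          simp [PF, hz.2]
      have h1 := Finset.card_le_card this
      rw [Finset.card_insert_of_notMem] at h1
      · omega
      · simp only [X0, Finset.mem_filter]
        rintro ⟨h2, _⟩
        exact hx (S.zero_mem_orb.mp h2)
    have hlam : ∀ g, g ≠ 0 → X1.card ≤ lam X g := by
      intro g hg
      obtain ⟨y, hy, hpy⟩ := hB g hg
      obtain ⟨b, rfl⟩ := S.mem_orb.mp hy
      rw [← S.lam_inv (S.orb_invSet x) b g]
      apply Finset.card_le_card
      intro z hz
      simp only [X1, Finset.mem_filter] at hz
      rw [Finset.mem_filter]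
      refine ⟨hz.1, ?_⟩
      rw [sub_eq_add_neg]
      exact hA _ (S.orb_invSet x) _ hz.1 hz.2 _ (by rw [smul_neg, hpy, neg_zero])
    have hs := sum_lam_ne X
    have hs2 : (Fintype.card A - 1) * X1.card ≤ ∑ g ∈ Finset.univ.erase 0, lam X g := by
      have := Finset.card_nsmul_le_sum (Finset.univ.erase (0 : A)) (fun g => lam X g) X1.card
        (fun g hg => hlam g (Finset.ne_of_mem_erase hg))
      rwa [Finset.card_erase_of_mem (Finset.mem_univ _), Finset.card_univ, smul_eq_mul] at this
    have hXpos : 0 < X.card := Finset.card_pos.mpr ⟨x, S.self_mem_orb x⟩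
    have hlt : 2 * X1.card < X.card := by
      by_contra hge
      push Not at hge
      obtain ⟨m, hm⟩ : ∃ m, Fintype.card A = m + 1 := ⟨Fintype.card A - 1, by omega⟩
      rw [hm] at hs2 hle
      simp only [Nat.add_sub_cancel] at hs2
      have h5 : 2 * X.card * X1.card ≤ m * X1.card := Nat.mul_le_mul_right _ (by omega)
      nlinarith
    have hX1 : X1 = ∅ := by
      by_contra hne1
      obtain ⟨z, hz⟩ := Finset.nonempty_iff_ne_empty.mpr hne1
      simp only [X1, Finset.mem_filter] at hz
      have hsub : PF.image (fun r => z + r) ⊆ X1 := by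
        intro w hw
        obtain ⟨r, hr, rfl⟩ := Finset.mem_image.mp hw
        simp only [PF, Finset.mem_filter, Finset.mem_univ, true_and] at hr
        simp only [X1, Finset.mem_filter]
        refine ⟨hA _ (S.orb_invSet x) _ hz.1 hz.2 _ hr, ?_⟩
        rw [smul_add, hr, add_zero]; exact hz.2
      have h6 := Finset.card_le_card hsub
      rw [Finset.card_image_of_injective _ (add_right_injective z)] at h6
      have h7 : X0.card ≤ PF.card := Finset.card_le_card (by
        intro w hw
        simp only [X0, Finset.mem_filter] at hw
        simp [PF, hw.2])
      omega
    have hsubP : AddSubgroup.closure (X : Set A) ≤ P := by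
      rw [AddSubgroup.closure_le]
      intro z hz
      by_contra hn
      have : z ∈ X1 := Finset.mem_filter.mpr ⟨hz, hn⟩
      rw [hX1] at this
      simp at this
    rcases hP _ (S.inv_closure (X : Set A) (fun b z hz => (S.orb_invSet x b z).mpr hz)) with hb | ht
    · have : x ∈ AddSubgroup.closure (X : Set A) := AddSubgroup.subset_closure (S.self_mem_orb x)
      rw [hb, AddSubgroup.mem_bot] at this
      exact hx this
    · rw [ht] at hsubP
      exact hPtop (top_le_iff.mp hsubP)
  intro x y hx hy
  by_contra hn
  have hdisj : Disjoint (S.orb x) (S.orb y) := by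
    rw [Finset.disjoint_left]
    intro z h1 h2
    apply hn
    rw [← S.orb_eq h1, S.orb_eq h2]
    exact S.self_mem_orb y
  have hc := Finset.card_le_univ (insert 0 (S.orb x ∪ S.orb y))
  rw [Finset.card_insert_of_notMem, Finset.card_union_of_disjoint hdisj] at hc
  · have := hC x hx
    have := hC y hy
    omega
  · rw [Finset.mem_union, S.zero_mem_orb, S.zero_mem_orb]
    exact not_or.mpr ⟨hx, hy⟩

theorem Trans.card_orb {S : SkewData S5 A} (ht : S.Trans) {x : A} (hx : x ≠ 0) :
    (S.orb x).card + 1 = Fintype.card A := by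
  have : S.orb x = Finset.univ.erase 0 := by
    ext y
    rw [Finset.mem_erase]
    constructor
    · intro hy
      refine ⟨?_, Finset.mem_univ _⟩
      rintro rfl
      exact hx (S.zero_mem_orb.mp hy)
    · rintro ⟨hy, _⟩
      exact ht x y hx hy
  rw [this, Finset.card_erase_of_mem (Finset.mem_univ _), Finset.card_univ]
  have : 0 < Fintype.card A := Fintype.card_pos
  omega

end SkewData

open Equiv.Perm

set_option linter.unusedSectionVars false
set_option linter.unusedDecidableInType false

namespace S5

theorem card_invol : (Finset.univ.filter (fun t : S5 => t * t = 1 ∧ t ≠ 1)).card = 25 := by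
  decide +kernel
theorem card_invol_odd :
    (Finset.univ.filter (fun t : S5 => t * t = 1 ∧ t ≠ 1 ∧ sign t = -1)).card = 10 := by
  decide +kernel
theorem card_invol_even :
    (Finset.univ.filter (fun t : S5 => t * t = 1 ∧ t ≠ 1 ∧ sign t = 1)).card = 15 := by
  decide +kernel

theorem four_dvd (K : Subgroup S5) {t u : S5} (ht : t ∈ K) (hu : u ∈ K) (hst : sign t = -1)
    (hsu : sign u = 1) (hu2 : u * u = 1) (hu1 : u ≠ 1) : 4 ∣ Nat.card K := by
  let f : K →* ℤˣ := (sign : S5 →* ℤˣ).comp K.subtype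
  have h1 := f.ker.card_mul_index
  rw [Subgroup.index_ker] at h1
  have hr : f.range = ⊤ := by
    rw [MonoidHom.range_eq_top]
    intro z
    rcases Int.units_eq_one_or z with rfl | rfl
    · exact ⟨1, map_one f⟩
    · exact ⟨⟨t, ht⟩, hst⟩
  have h2 : Nat.card f.range = 2 := by
    rw [hr, Subgroup.card_top]; simp
  have h3 : orderOf (⟨u, hu⟩ : K) = 2 := by
    apply orderOf_eq_prime
    · rw [pow_two]; exact Subtype.ext hu2
    · intro h; exact hu1 (congrArg Subtype.val h)
  have h4 : 2 ∣ Nat.card f.ker := by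
    rw [← h3]
    exact Subgroup.orderOf_dvd_natCard f.ker hsu
  rw [h2] at h1
  omega

end S5

namespace SkewData
variable {A : Type*} [AddCommGroup A] (S : SkewData S5 A)
variable [Fintype A] [DecidableEq A]

/-- Involutions (and possibly the identity) fixing only zero. -/
def invo : Finset S5 := Finset.univ.filter (fun t => t * t = 1 ∧ ∀ x, S.ps t x = x → x = 0)

theorem mem_invo {t : S5} : t ∈ S.invo ↔ t * t = 1 ∧ ∀ x, S.ps t x = x → x = 0 := by
  simp [invo]

theorem kill (ht : S.Trans) (h : ¬ S.Triv) :
    S.invo.card * (Fintype.card A - 1) ≤ 120 ∧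
    (S.invo.card * (Fintype.card A - 1) = 120 →
      ∀ t : S5, t * t = 1 → t ≠ 1 → t ∈ S.invo) := by
  let W : Finset (S5 × A) := Finset.univ.filter (fun q => q.2 ≠ 0 ∧ S.ps q.1 q.2 = - q.2)
  have memW : ∀ q, q ∈ W ↔ q.2 ≠ 0 ∧ S.ps q.1 q.2 = - q.2 := by intro q; simp [W]
  have hW : W.card ≤ 120 := by
    by_cases hx : ∃ x : A, x ≠ 0
    · obtain ⟨x, hx⟩ := hx
      have hfib : ∀ j ∈ Finset.univ.erase (0 : A), (W.filter (fun q => q.2 = j)).card ≤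
          Nat.card (S.stab x) := by
        intro j hj
        have hj0 := Finset.ne_of_mem_erase hj
        have hcard : Nat.card (S.stab x) = Nat.card (S.stab j) := by
          have h1 := S.card_orb_mul x
          have h2 := S.card_orb_mul j
          rw [S.orb_eq (ht x j hx hj0)] at h2
          have hpos : 0 < (S.orb x).card := Finset.card_pos.mpr ⟨x, S.self_mem_orb x⟩
          exact Nat.eq_of_mul_eq_mul_left hpos (h1.trans h2.symm)
        by_cases hne : (W.filter (fun q => q.2 = j)).Nonempty
        · obtain ⟨⟨b0, j0⟩, hq0⟩ := hne
          rw [Finset.mem_filter, memW] at hq0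
          obtain ⟨⟨_, hb0⟩, rfl⟩ := hq0
          simp only at hb0 hcard
          rw [hcard]
          have : Nat.card (S.stab j0) = (Finset.univ.filter (fun b => S.ps b j0 = j0)).card := by
            exact Nat.subtype_card _ (fun b => by simp [mem_stab])
          rw [this]
          apply Finset.card_le_card_of_injOn (fun q => q.1 * b0⁻¹)
          · rintro ⟨b, j⟩ hq
            rw [Finset.mem_coe, Finset.mem_filter, memW] at hq
            obtain ⟨⟨_, hb⟩, rfl⟩ := hq
            simp only at hb
            simp only [Finset.coe_filter, Finset.mem_univ, true_and, Set.mem_ofPred_eq]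
            rw [S.ps_mul, hb, ← hb0, S.ps_inv_ps]
          · rintro ⟨b, j⟩ hq ⟨b', j'⟩ hq' he
            rw [Finset.mem_coe, Finset.mem_filter] at hq hq'
            simp only at he hq hq'
            rw [mul_left_inj] at he
            rw [he, hq.2, hq'.2]
        · rw [Finset.not_nonempty_iff_eq_empty.mp hne]; simp
      have h1 : W.card = ∑ j ∈ Finset.univ.erase (0 : A), (W.filter (fun q => q.2 = j)).card := by
        apply Finset.card_eq_sum_card_fiberwise
        intro q hq
        rw [Finset.mem_coe, memW] at hq
        simp [hq.1]
      rw [h1]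
      refine (Finset.sum_le_card_nsmul _ _ _ hfib).trans ?_
      rw [Finset.card_erase_of_mem (Finset.mem_univ _), Finset.card_univ, smul_eq_mul,
        ← ht.card_orb hx, Nat.add_sub_cancel, S.card_orb_mul]
    · push Not at hx
      have : W = ∅ := by
        ext q; rw [memW]; simp [hx q.2]
      rw [this]; simp
  let Θ : S5 × A → S5 × A := fun q => (S.pw q.2 q.1, S.ps q.1 q.2 - q.2)
  have hΘ : ∀ t v, t * t = 1 → S.ps t v ≠ v → Θ (t, v) ∈ W := by
    intro t v h1 h2
    rw [memW]
    simp only [Θ]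
    refine ⟨sub_ne_zero.mpr h2, ?_⟩
    rw [← S.ps_sub, ← S.ps_mul, h1, S.ps_one]
    abel
  have hinj : ∀ t v t' v', t ∈ S.invo → Θ (t, v) = Θ (t', v') → v' = v ∧ t' = t := by
    intro t v t' v' h1 h2
    rw [mem_invo] at h1
    simp only [Θ, Prod.mk.injEq] at h2
    obtain ⟨e1, e2⟩ := h2
    have k1 := S.ps_sub t v (v - v')
    have k2 := S.ps_sub t' v' 0
    rw [S.ps_zero, zero_sub, zero_sub] at k2
    have e3 : v - v' - v = -v' := by abel
    rw [e3, e1, ← k2] at k1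
    have k3 : S.ps t (v - v') = v - v' := by
      have : S.ps t (v - v') = S.ps t v - S.ps t' v' := by rw [← sub_eq_iff_eq_add.mp k1 |>.symm]; abel
      rw [this]
      have e4 : S.ps t v = S.ps t' v' - v' + v := by rw [← e2]; abel
      rw [e4]; abel
    have k4 := h1.2 _ k3
    have hv : v' = v := (sub_eq_zero.mp k4).symm
    refine ⟨hv, ?_⟩
    rw [hv] at e1
    exact (S.pw v).injective e1.symm
  let Q := S.invo ×ˢ Finset.univ.erase (0 : A)
  have hQ : Q.card = S.invo.card * (Fintype.card A - 1) := by
    rw [Finset.card_product, Finset.card_erase_of_mem (Finset.mem_univ _), Finset.card_univ]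
  have hsub : Q.image Θ ⊆ W := by
    intro q hq
    obtain ⟨⟨t, v⟩, hm, rfl⟩ := Finset.mem_image.mp hq
    rw [Finset.mem_product] at hm
    have h1 := S.mem_invo.mp hm.1
    exact hΘ t v h1.1 (fun h2 => Finset.ne_of_mem_erase hm.2 (h1.2 v h2))
  have hcard : (Q.image Θ).card = Q.card := by
    apply Finset.card_image_of_injOn
    rintro ⟨t, v⟩ hm ⟨t', v'⟩ _ he
    rw [Finset.mem_coe, Finset.mem_product] at hm
    obtain ⟨h1, h2⟩ := hinj t v t' v' hm.1 he
    rw [h1, h2]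
  have hle := Finset.card_le_card hsub
  rw [hcard, hQ] at hle
  refine ⟨hle.trans hW, ?_⟩
  intro heq t' ht1 ht2
  have himg : Q.image Θ = W := Finset.eq_of_subset_of_card_le hsub (by rw [hcard, hQ, heq]; exact hW)
  have : ∃ v, S.ps t' v ≠ v := by
    by_contra hn
    push Not at hn
    exact ht2 (S.faithful h hn)
  obtain ⟨v', hv'⟩ := this
  have hm := hΘ t' v' ht1 hv'
  rw [← himg] at hm
  obtain ⟨⟨t, v⟩, hm, he⟩ := Finset.mem_image.mp hm
  rw [Finset.mem_product] at hm
  obtain ⟨_, h2⟩ := hinj t v t' v' hm.1 he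
  rw [h2]; exact hm.1

theorem invo_of_odd (hodd : ∀ x : A, x ≠ 0 → ¬ 2 ∣ Nat.card (S.stab x)) : 25 ≤ S.invo.card := by
  rw [← S5.card_invol]
  apply Finset.card_le_card
  intro t ht
  rw [Finset.mem_filter] at ht
  rw [mem_invo]
  refine ⟨ht.2.1, fun x hx => ?_⟩
  by_contra hx0
  apply hodd x hx0
  have h3 : orderOf t = 2 := orderOf_eq_prime (by rw [pow_two]; exact ht.2.1) ht.2.2
  rw [← h3]
  exact Subgroup.orderOf_dvd_natCard _ (S.mem_stab.mpr hx)

theorem invo_of_four (htr : S.Trans) (hodd : ∀ x : A, x ≠ 0 → ¬ 4 ∣ Nat.card (S.stab x)) :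
    10 ≤ S.invo.card := by
  by_cases h1 : ∀ t : S5, t * t = 1 → t ≠ 1 → sign t = -1 → t ∈ S.invo
  · rw [← S5.card_invol_odd]
    apply Finset.card_le_card
    intro t ht
    rw [Finset.mem_filter] at ht
    exact h1 t ht.2.1 ht.2.2.1 ht.2.2.2
  by_cases h2 : ∀ t : S5, t * t = 1 → t ≠ 1 → sign t = 1 → t ∈ S.invo
  · refine le_trans (by norm_num) (S5.card_invol_even.symm.le.trans (Finset.card_le_card ?_))
    intro t ht
    rw [Finset.mem_filter] at ht
    exact h2 t ht.2.1 ht.2.2.1 ht.2.2.2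
  exfalso
  push Not at h1 h2
  obtain ⟨t, t1, t2, t3, t4⟩ := h1
  obtain ⟨u, u1, u2, u3, u4⟩ := h2
  rw [mem_invo] at t4 u4
  push Not at t4 u4
  obtain ⟨x, hx, hx0⟩ := t4 t1
  obtain ⟨y, hy, hy0⟩ := u4 u1
  obtain ⟨b, hb⟩ := S.mem_orb.mp (htr y x hy0 hx0)
  apply hodd x hx0
  refine S5.four_dvd (S.stab x) (t := t) (u := b⁻¹ * u * b) hx ?_ t3 ?_ ?_ ?_
  · rw [mem_stab, S.ps_mul, S.ps_mul, ← hb, S.ps_inv_ps, hy]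
  · rw [sign_cj', u3]
  · have : b⁻¹ * u * b * (b⁻¹ * u * b) = b⁻¹ * (u * u) * b := by group
    rw [this, u1]; group
  · intro h
    apply u2
    have : u = b * (b⁻¹ * u * b) * b⁻¹ := by group
    rw [this, h]; group

theorem kill_all (ht : S.Trans) (h : ¬ S.Triv) {x : A} (hx : x ≠ 0) :
    (12 ≤ (S.orb x).card → 4 ∣ Nat.card (S.stab x)) ∧
    (5 ≤ (S.orb x).card → 2 ∣ Nat.card (S.stab x)) := by
  have hcard : ∀ y : A, y ≠ 0 → Nat.card (S.stab y) = Nat.card (S.stab x) := by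
    intro y hy
    have h1 := S.card_orb_mul x
    have h2 := S.card_orb_mul y
    rw [S.orb_eq (ht x y hx hy)] at h2
    have hpos : 0 < (S.orb x).card := Finset.card_pos.mpr ⟨x, S.self_mem_orb x⟩
    exact Nat.eq_of_mul_eq_mul_left hpos (h2.trans h1.symm)
  have hn : Fintype.card A - 1 = (S.orb x).card := by
    have := ht.card_orb hx
    omega
  obtain ⟨k1, k2⟩ := S.kill ht h
  rw [hn] at k1 k2
  constructor
  · intro h12
    by_contra h4
    have h10 := S.invo_of_four ht (fun y hy => by rw [hcard y hy]; exact h4)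
    have heq : S.invo.card * (S.orb x).card = 120 := by
      have : 10 * 12 ≤ S.invo.card * (S.orb x).card := Nat.mul_le_mul h10 h12
      omega
    have h25 : 25 ≤ S.invo.card := by
      rw [← S5.card_invol]
      apply Finset.card_le_card
      intro t ht
      rw [Finset.mem_filter] at ht
      exact k2 heq t ht.2.1 ht.2.2
    have : 25 * 12 ≤ S.invo.card * (S.orb x).card := Nat.mul_le_mul h25 h12
    omega
  · intro h5
    by_contra h2
    have h25 := S.invo_of_odd (fun y hy => by rw [hcard y hy]; exact h2)
    have : 25 * 5 ≤ S.invo.card * (S.orb x).card := Nat.mul_le_mul h25 h5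
    omega

end SkewData

open Equiv.Perm

set_option linter.unusedSectionVars false
set_option linter.unusedDecidableInType false

theorem card_fix_mod {A : Type*} [Fintype A] [DecidableEq A] (σ : Equiv.Perm A) (X : Finset A)
    (hX : ∀ x, σ x ∈ X ↔ x ∈ X) {q : ℕ} (hq : q.Prime) (hσ : σ ^ q = 1) :
    X.card ≡ (X.filter (fun x => σ x = x)).card [MOD q] := by
  have : Fact q.Prime := ⟨hq⟩
  let τ : Equiv.Perm {x // x ∈ X} := σ.subtypePerm hX
  have hτ : ∀ x, ((τ x : {x // x ∈ X}) : A) = σ x := fun x => rfl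
  have hpow : ∀ k (x : {x // x ∈ X}), (((τ ^ k) x : {x // x ∈ X}) : A) = (σ ^ k) x := by
    intro k
    induction k with
    | zero => intro x; simp
    | succ k ih => intro x; rw [pow_succ, pow_succ, Equiv.Perm.mul_apply, ih]; rfl
  have h1 : τ ^ (q ^ 1) = 1 := by
    rw [pow_one]
    ext x
    rw [hpow, hσ]; rfl
  have h2 := Equiv.Perm.card_compl_support_modEq h1
  rw [Fintype.card_coe] at h2
  have h3 : τ.supportᶜ.card = (X.filter (fun x => σ x = x)).card := by
    rw [← Finset.card_map (Function.Embedding.subtype _)]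
    congr 1
    ext x
    simp only [Finset.mem_map, Finset.mem_compl, Equiv.Perm.notMem_support,
      Function.Embedding.subtype_apply, Finset.mem_filter]
    constructor
    · rintro ⟨a, ha, rfl⟩
      exact ⟨a.2, by rw [← hτ, ha]⟩
    · rintro ⟨h, h'⟩
      exact ⟨⟨x, h⟩, Subtype.ext (by rw [hτ, h']), rfl⟩
  rw [h3] at h2
  exact h2.symm

theorem exists_odd_add {A : Type*} [AddCommGroup A] [Fintype A] [DecidableEq A] [h : IsAddCyclic A]
    {n : ℕ} (hc : Fintype.card A = n) [NeZero n] (hs : sign (Equiv.addLeft (1 : ZMod n)) = -1) :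
    ∃ g : A, sign (Equiv.addLeft g) = -1 := by
  obtain rfl : n = Nat.card A := by rw [← hc, Nat.card_eq_fintype_card]
  let e := zmodAddCyclicAddEquiv h
  refine ⟨e 1, ?_⟩
  rw [← hs, ← sign_permCongr e.toEquiv]
  congr 1
  ext x
  simp [Equiv.permCongr_apply]

theorem odd16 : sign (Equiv.addLeft (1 : ZMod 16)) = -1 := by decide +kernel
theorem odd6 : sign (Equiv.addLeft (1 : ZMod 6)) = -1 := by decide +kernel

namespace SkewData
variable {A : Type*} [AddCommGroup A] [Fintype A] [DecidableEq A] (S : SkewData S5 A)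

theorem act_rel (b : S5) (v : A) :
    S.act b⁻¹ * Equiv.addLeft v = Equiv.addLeft (S.ps b v) * S.act (S.pw v b)⁻¹ := by
  ext x
  simp only [Equiv.Perm.mul_apply, act_apply, inv_inv, Equiv.coe_addLeft]
  exact S.ps_add b v x

theorem sign_act_A5 {a : S5} (ha : a ∈ A5) : sign (S.act a) = 1 :=
  S5.hom_trivial (fun a => sign (S.act a)) (fun a _ b _ => by simp) a ha

theorem parity (hP : S.Prim) {g : A} (hg : sign (Equiv.addLeft g) = -1)
    (h : ∀ v b, sign (S.act (S.pw v b)) = sign (S.act b)) : Fintype.card A ≤ 2 := by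
  have hτ : ∀ v b, sign (Equiv.addLeft (S.ps b v)) = sign (Equiv.addLeft v) := by
    intro v b
    have h1 := congrArg sign (S.act_rel b v)
    rw [map_mul, map_mul, map_inv S.act, map_inv S.act, sign_inv, sign_inv, h v b, mul_comm] at h1
    exact (mul_right_cancel h1).symm
  have hadd : ∀ v w : A, sign (Equiv.addLeft (v + w)) =
      sign (Equiv.addLeft v) * sign (Equiv.addLeft w) := by
    intro v w
    rw [← map_mul]
    congr 1
    ext x
    simp
  let f : A →+ Additive ℤˣ :=
    AddMonoidHom.mk' (fun v => Additive.ofMul (sign (Equiv.addLeft v)))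
      (fun v w => by rw [hadd, ofMul_mul])
  have hf : ∀ v, v ∈ f.ker ↔ sign (Equiv.addLeft v) = 1 := fun v => Iff.rfl
  have hinv : S.Inv f.ker := by
    intro b d hd
    rw [hf] at *
    rw [hτ, hd]
  rcases hP _ hinv with h1 | h1
  · have hinj := (AddMonoidHom.ker_eq_bot_iff f).mp h1
    have := Fintype.card_le_of_injective f hinj
    simpa using this
  · exfalso
    have : g ∈ f.ker := by rw [h1]; trivial
    rw [hf, hg] at this
    exact absurd this (by decide)

theorem ne16 (hP : S.Prim) (h : ¬ S.Triv) [IsAddCyclic A] (hc : Fintype.card A = 16) : False := by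
  have ht : S.Trans := S.trans_of_composite hP h Nat.prime_two (by rw [hc]; norm_num)
    (by rw [hc]; norm_num)
  obtain ⟨g, hg⟩ := exists_odd_add (A := A) hc odd16
  by_cases hs : ∀ b, sign (S.act b) = 1
  · have := S.parity hP hg (fun v b => by rw [hs, hs])
    omega
  push Not at hs
  obtain ⟨b, hb⟩ := hs
  have hb1 : sign (S.act b) = -1 := (Int.units_eq_one_or _).resolve_left hb
  have hbs : sign b = -1 := by
    refine (Int.units_eq_one_or _).resolve_left fun h1 => hb (S.sign_act_A5 ?_)
    rwa [mem_alternatingGroup]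
  have hodd : ∀ t : S5, sign t = -1 → sign (S.act t) = -1 := by
    intro t ht
    have h1 : b⁻¹ * t ∈ A5 := by
      rw [mem_alternatingGroup, map_mul, sign_inv, hbs, ht]; decide
    have h2 := S.sign_act_A5 h1
    rw [map_mul, map_mul, map_inv, sign_inv, hb1] at h2
    rcases Int.units_eq_one_or (sign (S.act t)) with h3 | h3
    · rw [h3] at h2; exact absurd h2 (by decide)
    · exact h3
  have hstab : ∀ (c : S5) (x : A), orderOf c = 3 → S.ps c x = x → x = 0 := by
    intro c x hc3 hcx
    by_contra hx
    have h1 := ht.card_orb hx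
    have h2 := S.card_orb_mul x
    have h3 : (S.orb x).card = 15 := by omega
    rw [h3] at h2
    have h4 : 3 ∣ Nat.card (S.stab x) := by
      rw [← hc3, ← Subgroup.orderOf_mk c ((S.mem_stab).mpr hcx)]
      exact orderOf_dvd_natCard _
    omega
  have hfix : ∀ t c : S5, sign t = -1 → t * t = 1 → c ^ 3 = 1 → c ≠ 1 → t * c = c * t →
      (Finset.univ.filter (fun x => S.ps t x = x)).card = 10 := by
    intro t c h1 h2 h3 h3' h4
    have hti : t⁻¹ = t := inv_eq_of_mul_eq_one_left h2
    have ho := hodd t h1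
    have hp : S.act t ^ 2 = 1 := by rw [← map_pow, pow_two, h2, map_one]
    rw [sign_of_pow_two_eq_one hp, hc] at ho
    have hcf : Fintype.card (Function.fixedPoints (S.act t)) =
        (Finset.univ.filter (fun x => S.ps t x = x)).card := by
      rw [Fintype.card_subtype]
      congr 1
      ext x
      simp only [Finset.mem_filter, Finset.mem_univ, true_and]
      rw [Function.mem_fixedPoints, Function.IsFixedPt, act_apply, hti]
    rw [hcf] at ho
    set F := Finset.univ.filter (fun x => S.ps t x = x) with hF
    have hmod2 : 16 ≡ F.card [MOD 2] := by
      have := card_fix_mod (S.act t) Finset.univ (by simp) Nat.prime_two hp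
      rw [Finset.card_univ, hc] at this
      convert this using 5
      rw [act_apply, hti]
    have hmod3 : F.card ≡ 1 [MOD 3] := by
      have hcinv : S.act c⁻¹ ^ 3 = 1 := by rw [← map_pow, inv_pow, h3, inv_one, map_one]
      have hFc : ∀ x, S.act c⁻¹ x ∈ F ↔ x ∈ F := by
        intro x
        rw [act_apply, inv_inv, hF, Finset.mem_filter, Finset.mem_filter, ← S.ps_mul, ← h4,
          S.ps_mul, (S.ps_injective c).eq_iff]
        simp
      have := card_fix_mod (S.act c⁻¹) F hFc Nat.prime_three hcinv
      have h0 : F.filter (fun x => S.act c⁻¹ x = x) = {0} := by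
        ext x
        rw [Finset.mem_filter, act_apply, inv_inv, Finset.mem_singleton]
        constructor
        · rintro ⟨_, hx⟩
          exact hstab c x (orderOf_eq_prime h3 h3') hx
        · rintro rfl
          exact ⟨by simp [hF, S.ps_zero], S.ps_zero _⟩
      rw [h0, Finset.card_singleton] at this
      exact this
    have hle : F.card ≤ 16 := by rw [← hc]; exact Finset.card_le_univ F
    generalize F.card = k at *
    unfold Nat.ModEq at *
    interval_cases k <;> first | omega | exact absurd ho (by decide)
  have f1 := hfix (Equiv.swap 0 1) (Equiv.swap 2 3 * Equiv.swap 3 4) (by decide) (by decide)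
    (by decide) (by decide) (by decide)
  have f2 := hfix (Equiv.swap 1 2) (Equiv.swap 0 3 * Equiv.swap 3 4) (by decide) (by decide)
    (by decide) (by decide) (by decide)
  set F1 := Finset.univ.filter (fun x => S.ps (Equiv.swap 0 1) x = x) with hF1
  set F2 := Finset.univ.filter (fun x => S.ps (Equiv.swap 1 2) x = x) with hF2
  have hsub : F1 ∩ F2 ⊆ {0} := by
    intro x hx
    rw [Finset.mem_inter, hF1, hF2, Finset.mem_filter, Finset.mem_filter] at hx
    rw [Finset.mem_singleton]
    refine hstab (Equiv.swap 0 1 * Equiv.swap 1 2) x ?_ (by rw [S.ps_mul, hx.1.2, hx.2.2])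
    apply orderOf_eq_prime <;> decide
  have h1 := Finset.card_le_card hsub
  have h2 := Finset.card_union_add_card_inter F1 F2
  have h3 : (F1 ∪ F2).card ≤ 16 := by rw [← hc]; exact Finset.card_le_univ _
  rw [Finset.card_singleton] at h1
  omega

theorem composite (hP : S.Prim) (h : ¬ S.Triv) [IsAddCyclic A] (hnp : ¬ (Fintype.card A).Prime) :
    Fintype.card A = 6 := by
  have hx : ∃ x : A, x ≠ 0 := by
    by_contra h0
    push Not at h0
    exact h fun a _ i => by rw [h0 i, S.ps_zero]
  obtain ⟨x, hx⟩ := hx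
  have hpos : 1 < Fintype.card A := Fintype.one_lt_card_iff.mpr ⟨x, 0, hx⟩
  have ht : S.Trans := S.trans_of_composite hP h (Nat.minFac_prime (n := Fintype.card A) (by omega))
    (Nat.minFac_dvd _) (fun h1 => hnp (h1 ▸ Nat.minFac_prime (by omega)))
  have h1 := ht.card_orb hx
  have h2 := S.card_orb_mul x
  have h3 := S.card_orb_ge hP h hx
  obtain ⟨k1, k2⟩ := S.kill_all ht h hx
  have h16 := S.ne16 hP h
  have hle : (S.orb x).card ≤ 120 := Nat.le_of_dvd (by norm_num) ⟨_, h2.symm⟩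
  rw [← h1] at hnp h16 ⊢
  generalize (S.orb x).card = k at *
  generalize Nat.card (S.stab x) = m at *
  have hk : k ∣ 120 := ⟨_, h2.symm⟩
  have hk2 : k ∈ Nat.divisors 120 := by simp [hk]
  have hk3 : Nat.divisors 120 = {1,2,3,4,5,6,8,10,12,15,20,24,30,40,60,120} := by decide +kernel
  rw [hk3] at hk2
  simp only [Finset.mem_insert, Finset.mem_singleton] at hk2
  rcases hk2 with rfl | rfl | rfl | rfl | rfl | rfl | rfl | rfl | rfl | rfl | rfl | rfl | rfl | rfl |
    rfl | rfl <;> first | omega | (exfalso; exact h16 rfl) | (exfalso; revert hnp; norm_num)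

end SkewData

open Equiv.Perm

set_option linter.unusedSectionVars false
set_option linter.unusedDecidableInType false

namespace SkewData
variable {p : ℕ} [hp : Fact p.Prime] (S : SkewData S5 (ZMod p))

theorem prime_prim : S.Prim := by
  intro D _
  have : IsSimpleAddGroup (ZMod p) := isSimpleAddGroup_of_prime_card (p := p) (by simp)
  exact IsSimpleAddGroup.eq_bot_or_eq_top_of_normal D inferInstance

theorem mul_inv_prime (X : Finset (ZMod p)) (hX : S.InvSet X) {q : ℕ} (hq : q.Prime)
    (hqp : ¬ p ∣ q) : S.InvSet (X.image (fun x => (q : ZMod p) * x)) := by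
  have hf := S.frob q hq X hX
  have hq0 : (q : ZMod p) ≠ 0 := by rwa [Ne, ZMod.natCast_eq_zero_iff]
  have : Fact q.Prime := ⟨hq⟩
  have key : ∀ y : ZMod p, ((X.filter (fun x => q • x = y)).card : ZMod q) =
      if y ∈ X.image (fun x => (q : ZMod p) * x) then 1 else 0 := by
    intro y
    split_ifs with hy
    · obtain ⟨x, hx, rfl⟩ := Finset.mem_image.mp hy
      have : X.filter (fun x' => q • x' = (q : ZMod p) * x) = {x} := by
        ext z
        rw [Finset.mem_filter, Finset.mem_singleton, nsmul_eq_mul]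
        constructor
        · rintro ⟨_, h⟩; exact mul_left_cancel₀ hq0 h
        · rintro rfl; exact ⟨hx, rfl⟩
      rw [this]; simp
    · have : X.filter (fun x' => q • x' = y) = ∅ := by
        rw [Finset.filter_eq_empty_iff]
        intro x hx h
        exact hy (Finset.mem_image.mpr ⟨x, hx, by rw [← h, nsmul_eq_mul]⟩)
      rw [this]; simp
  intro b y
  have h1 := hf b y
  simp only [key] at h1
  by_cases h2 : S.ps b y ∈ X.image (fun x => (q : ZMod p) * x) <;>
    by_cases h3 : y ∈ X.image (fun x => (q : ZMod p) * x) <;> simp [h2, h3] at h1 ⊢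

theorem mul_inv_nat (k : ℕ) : ¬ p ∣ k → ∀ (X : Finset (ZMod p)), S.InvSet X →
    S.InvSet (X.image (fun x => (k : ZMod p) * x)) := by
  induction k using induction_on_primes with
  | zero => intro h; exact absurd (dvd_zero p) h
  | one => intro _ X hX; simpa using hX
  | prime_mul q a hq ih =>
    intro h X hX
    have h1 := ih (fun h' => h (h'.mul_left q)) X hX
    have h2 := S.mul_inv_prime _ h1 hq (fun h' => h (h'.mul_right a))
    rw [Finset.image_image] at h2
    convert h2 using 2
    ext x
    simp [mul_assoc]

theorem mul_inv (m : ZMod p) (hm : m ≠ 0) (X : Finset (ZMod p)) (hX : S.InvSet X) :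
    S.InvSet (X.image (fun x => m * x)) := by
  have := S.mul_inv_nat m.val (fun h => hm (by
    rw [← ZMod.natCast_zmod_val m, ZMod.natCast_eq_zero_iff]; exact h)) X hX
  simpa using this

theorem orb_sub {X : Finset (ZMod p)} (hX : S.InvSet X) {x : ZMod p} (hx : x ∈ X) :
    S.orb x ⊆ X := by
  intro y hy
  obtain ⟨b, rfl⟩ := S.mem_orb.mp hy
  exact (hX b x).mpr hx

theorem orb_one_ne {x : ZMod p} (hx : x ∈ S.orb 1) : x ≠ 0 := by
  rintro rfl
  exact one_ne_zero (S.zero_mem_orb.mp hx)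

theorem orb_one_mul {m x : ZMod p} (hm : m ∈ S.orb 1) (hx : x ∈ S.orb 1) : m * x ∈ S.orb 1 := by
  have hm0 := S.orb_one_ne hm
  have h1 := S.mul_inv m hm0 (S.orb 1) (S.orb_invSet 1)
  have h2 : S.orb m ⊆ (S.orb 1).image (fun x => m * x) :=
    S.orb_sub h1 (Finset.mem_image.mpr ⟨1, S.self_mem_orb 1, mul_one m⟩)
  rw [S.orb_eq hm] at h2
  have h3 := Finset.eq_of_subset_of_card_le h2 Finset.card_image_le
  rw [h3]
  exact Finset.mem_image_of_mem _ hx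

/-- The orbit of one as a group of units. -/
def orbSub : Subgroup (ZMod p)ˣ where
  carrier := {u | (u : ZMod p) ∈ S.orb 1}
  one_mem' := by
    rw [Set.mem_ofPred_eq, Units.val_one]; exact S.self_mem_orb 1
  mul_mem' := by
    intro a b ha hb
    rw [Set.mem_ofPred_eq] at *
    rw [Units.val_mul]; exact S.orb_one_mul ha hb
  inv_mem' := by
    intro u hu
    rw [Set.mem_ofPred_eq] at *
    have h : ∀ k : ℕ, ((u ^ k : (ZMod p)ˣ) : ZMod p) ∈ S.orb 1 := by
      intro k
      induction k with
      | zero => rw [pow_zero, Units.val_one]; exact S.self_mem_orb 1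
      | succ k ih => rw [pow_succ, Units.val_mul]; exact S.orb_one_mul ih hu
    have h1 : u⁻¹ = u ^ (orderOf u - 1) := by
      rw [inv_eq_iff_mul_eq_one, ← pow_succ', Nat.sub_add_cancel (orderOf_pos u), pow_orderOf_eq_one]
    rw [h1]; exact h _

theorem mem_orbSub {u : (ZMod p)ˣ} : u ∈ S.orbSub ↔ (u : ZMod p) ∈ S.orb 1 := Iff.rfl

theorem card_orbSub : Nat.card S.orbSub = (S.orb 1).card := by
  rw [← Fintype.card_coe (S.orb 1), ← Nat.card_eq_fintype_card]
  refine Nat.card_eq_of_bijective (fun u : S.orbSub =>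
    (⟨((u : (ZMod p)ˣ) : ZMod p), S.mem_orbSub.mp u.2⟩ : {x // x ∈ S.orb 1})) ⟨?_, ?_⟩
  · intro u v huv
    exact Subtype.ext (Units.ext (congrArg Subtype.val huv))
  · rintro ⟨x, hx⟩
    exact ⟨⟨Units.mk0 x (S.orb_one_ne hx), S.mem_orbSub.mpr hx⟩, rfl⟩

theorem card_orb_dvd_pred : (S.orb 1).card ∣ p - 1 := by
  rw [← card_orbSub, ← ZMod.card_units p, ← Nat.card_eq_fintype_card]
  exact Subgroup.card_subgroup_dvd_card _

theorem orb_pow {x : ZMod p} (hx : x ∈ S.orb 1) : x ^ (S.orb 1).card = 1 := by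
  have h1 : Units.mk0 x (S.orb_one_ne hx) ∈ S.orbSub := S.mem_orbSub.mpr hx
  have h2 : (⟨_, h1⟩ : S.orbSub) ^ Nat.card S.orbSub = 1 := pow_card_eq_one'
  rw [card_orbSub] at h2
  have h3 := congrArg (fun u : S.orbSub => ((u : (ZMod p)ˣ) : ZMod p)) h2
  simpa using h3

theorem pw_nat (k : ℕ) : S.pw (k : ZMod p) = S.pw 1 ^ k := by
  induction k with
  | zero => simp [S.pw_zero]
  | succ k ih => rw [Nat.cast_succ, S.pw_add, ih, pow_succ]

theorem pw_nsmul (k : ℕ) (i : ZMod p) : S.pw (k * i) = S.pw i ^ k := by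
  induction k with
  | zero => simp [S.pw_zero]
  | succ k ih => rw [Nat.cast_succ, add_mul, one_mul, S.pw_add, ih, pow_succ]

theorem pw_fix {i : ZMod p} (hi : i ≠ 0) {b : S5} (hb : S.pw i b = b) (j : ZMod p) :
    S.pw j b = b := by
  have h : ∀ k : ℕ, (S.pw i ^ k) b = b := by
    intro k
    induction k with
    | zero => rfl
    | succ k ih => rw [pow_succ, Equiv.Perm.mul_apply, hb, ih]
  have h1 : j = ((j / i).val : ZMod p) * i := by
    rw [ZMod.natCast_zmod_val, div_mul_cancel₀ _ hi]
  rw [h1, S.pw_nsmul, h]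

/-- Elements fixed by all powers. -/
def phi : Subgroup S5 where
  carrier := {b | ∀ i, S.pw i b = b}
  one_mem' := fun i => S.pw_one i
  mul_mem' := by
    intro a b ha hb i
    rw [S.pw_mul, ha, hb]
  inv_mem' := by
    intro a ha i
    have := S.pw_inv (S.ps a⁻¹ i) a
    rw [S.ps_ps_inv, ha] at this
    exact this.symm

theorem mem_phi {b : S5} : b ∈ S.phi ↔ ∀ i, S.pw i b = b := Iff.rfl

theorem phi_linear {b : S5} (hb : b ∈ S.phi) (i : ZMod p) : S.ps b i = i * S.ps b 1 := by
  have h : ∀ k : ℕ, S.ps b k = k * S.ps b 1 := by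
    intro k
    induction k with
    | zero => simp [S.ps_zero]
    | succ k ih => rw [Nat.cast_succ, S.ps_add, ih, hb, add_mul, one_mul]
  have := h i.val
  rwa [ZMod.natCast_zmod_val] at this

theorem card_phi_le (h : ¬ S.Triv) : Nat.card S.phi ≤ 6 := by
  let f : S.phi →* ZMod p :=
    { toFun := fun b => S.ps b 1
      map_one' := S.ps_one 1
      map_mul' := by
        intro a b
        change S.ps ((a : S5) * (b : S5)) 1 = _
        rw [S.ps_mul, S.phi_linear b.2] }
  have hf : Function.Injective f := by
    intro a b hab
    have hab' : S.ps a 1 = S.ps b 1 := hab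
    have : (a : S5) * (b : S5)⁻¹ = 1 := by
      apply S.faithful h
      intro i
      rw [S.ps_mul, S.phi_linear a.2, hab', ← S.phi_linear b.2, S.ps_inv_ps]
    exact Subtype.ext (mul_inv_eq_one.mp this)
  have : IsCyclic S.phi := isCyclic_of_injective_ringHom f hf
  obtain ⟨g, hg⟩ := IsCyclic.exists_generator (α := S.phi)
  rw [← orderOf_eq_card_of_forall_mem_zpowers hg, ← Subgroup.orderOf_coe]
  exact S5.order_le _

theorem card_phi_mod : 120 ≡ Nat.card S.phi [MOD p] := by
  have h1 : S.pw 1 ^ p = 1 := by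
    rw [← S.pw_nat, ZMod.natCast_self, S.pw_zero]
  have h2 := card_fix_mod (S.pw 1) Finset.univ (by simp) hp.out h1
  rw [Finset.card_univ, S5.card_eq] at h2
  have h3 : Nat.card S.phi = (Finset.univ.filter (fun b => S.pw 1 b = b)).card := by
    refine Nat.subtype_card _ (fun b => ?_)
    rw [Finset.mem_filter]
    constructor
    · rintro ⟨_, hb⟩; exact fun i => S.pw_fix one_ne_zero hb i
    · intro hb; exact ⟨Finset.mem_univ _, hb 1⟩
  rwa [h3]

theorem free_case (h : ¬ S.Triv) (h7 : 7 ≤ p) (he : Nat.card S.phi = 1) : False := by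
  have hphi : S.phi = ⊥ := Subgroup.card_eq_one.mp he
  let Lh : S5 →* Equiv.Perm S5 := MulAction.toPermHom S5 S5
  have hL : ∀ a c, Lh a c = a * c := fun a c => rfl
  have conj1 : ∀ b k, (Lh b)⁻¹ * S.pw k * Lh b = Lh (b⁻¹ * S.pw k b) * S.pw (S.ps b k) := by
    intro b k
    ext1 c
    rw [← map_inv, Equiv.Perm.mul_apply, Equiv.Perm.mul_apply, Equiv.Perm.mul_apply, hL, hL, hL,
      S.pw_mul, mul_assoc]
  have conj2 : ∀ a i, S.pw i * Lh a * (S.pw i)⁻¹ = Lh (S.pw i a) * S.pw (S.ps a i - i) := by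
    intro a i
    rw [mul_inv_eq_iff_eq_mul, mul_assoc, ← S.pw_add, sub_add_cancel]
    ext1 c
    rw [Equiv.Perm.mul_apply, Equiv.Perm.mul_apply, hL, hL, S.pw_mul]
  have pwp : ∀ k, S.pw k ^ p = 1 := by
    intro k
    rw [← S.pw_nsmul, ZMod.natCast_self, zero_mul, S.pw_zero]
  let F : S5 × {k : ZMod p // k ≠ 0} → S5 × {k : ZMod p // k ≠ 0} :=
    fun q => (q.1⁻¹ * S.pw q.2 q.1, ⟨S.ps q.1 q.2, fun h0 => q.2.2 (S.ps_eq_zero.mp h0)⟩)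
  have hF : Function.Injective F := by
    rintro ⟨b, k, hk⟩ ⟨b', k', hk'⟩ hbb
    have e1 : b⁻¹ * S.pw k b = b'⁻¹ * S.pw k' b' := congrArg Prod.fst hbb
    have e2 : S.ps b k = S.ps b' k' := congrArg (fun q => (q.2 : ZMod p)) hbb
    have e3 : (Lh b)⁻¹ * S.pw k * Lh b = (Lh b')⁻¹ * S.pw k' * Lh b' := by
      rw [conj1, conj1, e1, e2]
    have e4 : S.pw k * Lh (b * b'⁻¹) = Lh (b * b'⁻¹) * S.pw k' := by
      rw [map_mul, map_inv]
      calc S.pw k * (Lh b * (Lh b')⁻¹) = Lh b * ((Lh b)⁻¹ * S.pw k * Lh b) * (Lh b')⁻¹ := by group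
        _ = _ := by rw [e3]; group
    have e5 := congrArg (fun f => f 1) e4
    simp only [Equiv.Perm.mul_apply, hL, mul_one, S.pw_one] at e5
    have e6 : b * b'⁻¹ ∈ S.phi := fun i => S.pw_fix hk e5 i
    rw [hphi, Subgroup.mem_bot, mul_inv_eq_one] at e6
    subst e6
    have e7 := S.ps_injective _ e2
    subst e7
    rfl
  have hsurj := Finite.injective_iff_surjective.mp hF
  have key : ∀ a j, j ≠ 0 → (Lh a * S.pw j) ^ p = 1 := by
    intro a j hj
    obtain ⟨⟨b, k⟩, hbk⟩ := hsurj (a, ⟨j, hj⟩)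
    have e1 : b⁻¹ * S.pw k b = a := congrArg Prod.fst hbk
    have e2 : S.ps b k = j := congrArg (fun q => (q.2 : ZMod p)) hbk
    rw [← e1, ← e2, ← conj1]
    have := conj_pow (i := p) (a := (Lh b)⁻¹) (b := S.pw k)
    rw [inv_inv] at this
    rw [this, pwp]; group
  apply h
  intro a _ i
  by_contra hne
  have h1 := key (S.pw i a) (S.ps a i - i) (sub_ne_zero.mpr hne)
  rw [← conj2, conj_pow, mul_inv_eq_one, mul_eq_left] at h1
  rw [← map_pow] at h1
  have h2 := congrArg (fun f => f 1) h1
  simp only [hL, mul_one, Equiv.Perm.one_apply] at h2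
  have h3 := orderOf_dvd_of_pow_eq_one h2
  rcases (Nat.dvd_prime hp.out).mp h3 with h4 | h4
  · rw [orderOf_eq_one_iff] at h4
    apply hne; rw [h4, S.ps_one]
  · have := S5.order_le a
    omega

theorem six_orbit (h : ¬ S.Triv) (hc : (S.orb 1).card = 6)
    (h6 : (Finset.univ.filter (fun x : ZMod p => x ^ 6 = 1)).card = 6)
    (h2 : (Finset.univ.filter (fun x : ZMod p => x ^ 6 = 1 ∧ (x - 1) ^ 6 = 1)).card = 2) :
    False := by
  have hX : S.orb 1 = Finset.univ.filter (fun x : ZMod p => x ^ 6 = 1) := by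
    apply Finset.eq_of_subset_of_card_le
    · intro x hx
      rw [Finset.mem_filter]
      exact ⟨Finset.mem_univ _, by rw [← hc]; exact S.orb_pow hx⟩
    · rw [h6, hc]
  have hst := S.card_orb_mul 1
  rw [hc] at hst
  have h5 : 5 ∣ Nat.card (S.stab 1) := by omega
  have : Fact (Nat.Prime 5) := ⟨by norm_num⟩
  obtain ⟨⟨c, hcs⟩, hco⟩ := exists_prime_orderOf_dvd_card' 5 h5
  rw [Subgroup.orderOf_mk] at hco
  have hc1 : S.ps c 1 = 1 := hcs
  let N : Subgroup S5 :=
    { carrier := {b | ∀ x ∈ S.orb 1, S.ps b x = x}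
      one_mem' := fun x _ => S.ps_one x
      mul_mem' := by
        intro a b ha hb x hx
        rw [S.ps_mul, ha x hx, hb x hx]
      inv_mem' := by
        intro a ha x hx
        conv_lhs => rw [← ha x hx]
        rw [S.ps_inv_ps] }
  have hNn : N.Normal := by
    constructor
    intro n hn g x hx
    rw [S.ps_mul, S.ps_mul, hn _ ((S.ps_mem_orb g).mpr hx), S.ps_inv_ps]
  have hcN : c ∉ N := by
    intro hcN
    have hne : N ≠ ⊥ := by
      intro hb
      rw [hb, Subgroup.mem_bot] at hcN
      rw [hcN, orderOf_one] at hco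
      omega
    have hle := S5.normal_ge N hNn hne
    exact one_ne_zero (S.eq_zero_of_fixed S.prime_prim h
      (fun a ha => hle ha 1 (S.self_mem_orb 1)))
  have hcp : S.act c⁻¹ ^ 5 = 1 := by
    have hc5 : c ^ 5 = 1 := orderOf_dvd_iff_pow_eq_one.mp (by rw [hco])
    rw [← map_pow, inv_pow, hc5, inv_one, map_one]
  have hfix := card_fix_mod (S.act c⁻¹) (S.orb 1)
    (fun x => by rw [act_apply]; exact S.ps_mem_orb _) (by norm_num) hcp
  simp only [act_apply, inv_inv] at hfix
  rw [hc] at hfix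
  have hlt : ((S.orb 1).filter (fun x => S.ps c x = x)).card < 6 := by
    rw [← hc]
    apply Finset.card_lt_card
    rw [Finset.filter_ssubset]
    by_contra hall
    push Not at hall
    exact hcN hall
  have hone : ((S.orb 1).filter (fun x => S.ps c x = x)).card = 1 := by
    unfold Nat.ModEq at hfix
    omega
  obtain ⟨z, hz⟩ := Finset.card_eq_one.mp hone
  have h1z : (1 : ZMod p) = z := by
    rw [← Finset.mem_singleton, ← hz, Finset.mem_filter]
    exact ⟨S.self_mem_orb 1, hc1⟩
  let Y := Finset.univ.filter (fun x : ZMod p => x ^ 6 = 1 ∧ (x - 1) ^ 6 = 1)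
  have hm : ∀ x, x ∈ S.orb 1 ↔ x ^ 6 = 1 := by intro x; rw [hX]; simp
  have hY : ∀ x, x ∈ Y ↔ x ∈ S.orb 1 ∧ x - 1 ∈ S.orb 1 := by
    intro x; rw [hm, hm]; simp [Y]
  have hYi : ∀ x, S.act c⁻¹ x ∈ Y ↔ x ∈ Y := by
    intro x
    rw [act_apply, inv_inv, hY, hY, S.ps_mem_orb]
    have : S.ps c x - 1 = S.ps (S.pw 1 c) (x - 1) := by rw [← S.ps_sub, hc1]
    rw [this, S.ps_mem_orb]
  have hYf := card_fix_mod (S.act c⁻¹) Y hYi (by norm_num : Nat.Prime 5) hcp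
  have hYe : Y.filter (fun x => S.act c⁻¹ x = x) = ∅ := by
    rw [Finset.filter_eq_empty_iff]
    intro x hx hxf
    rw [act_apply, inv_inv] at hxf
    rw [hY] at hx
    have : x ∈ (S.orb 1).filter (fun x => S.ps c x = x) := Finset.mem_filter.mpr ⟨hx.1, hxf⟩
    rw [hz, Finset.mem_singleton, ← h1z] at this
    rw [this, sub_self] at hx
    exact S.orb_one_ne hx.2 rfl
  rw [hYe, h2, Finset.card_empty] at hYf
  exact absurd hYf (by decide)

theorem c13a : (Finset.univ.filter (fun x : ZMod 13 => x ^ 6 = 1)).card = 6 := by decide +kernel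
theorem c13b : (Finset.univ.filter (fun x : ZMod 13 => x ^ 6 = 1 ∧ (x - 1) ^ 6 = 1)).card = 2 := by
  decide +kernel
theorem c19a : (Finset.univ.filter (fun x : ZMod 19 => x ^ 6 = 1)).card = 6 := by decide +kernel
theorem c19b : (Finset.univ.filter (fun x : ZMod 19 => x ^ 6 = 1 ∧ (x - 1) ^ 6 = 1)).card = 2 := by
  decide +kernel

theorem prime_case (h : ¬ S.Triv) : False := by
  have h5 := S.card_orb_ge S.prime_prim h (one_ne_zero (α := ZMod p))
  have hst := S.card_orb_mul 1
  have hd := S.card_orb_dvd_pred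
  have hle := S.card_phi_le h
  have hpos : 0 < Nat.card S.phi := Nat.card_pos
  have hmod := (Nat.modEq_iff_dvd' (by omega)).mp S.card_phi_mod.symm
  have h2 := hp.out.two_le
  have hp5 : 6 ≤ p := by have := Nat.le_of_dvd (by omega) hd; omega
  have hfree := S.free_case h
  have hplist : p = 7 ∧ Nat.card S.phi = 1 ∨ p = 17 ∧ Nat.card S.phi = 1 ∨ p = 59 ∨ p = 13 ∨
      p = 29 ∨ p = 23 ∨ p = 19 := by
    generalize Nat.card S.phi = e at *
    have key : ∀ e ∈ Finset.Icc 1 6, ∀ p ∈ Finset.range 121, p ∣ 120 - e → 6 ≤ p →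
        (∀ m ∈ Finset.Icc 2 7, m ∣ p → m = p) →
        p = 7 ∧ e = 1 ∨ p = 17 ∧ e = 1 ∨ p = 59 ∨ p = 13 ∨ p = 29 ∨ p = 23 ∨ p = 19 := by
      decide +kernel
    refine key e (by rw [Finset.mem_Icc]; omega) p ?_ hmod hp5 ?_
    · have := Nat.le_of_dvd (by omega) hmod
      rw [Finset.mem_range]; omega
    · intro m hm
      rw [Finset.mem_Icc] at hm
      intro hmp
      rcases (Nat.dvd_prime hp.out).mp hmp with h | h
      · omega
      · exact h
  have hcd : (S.orb 1).card ∣ 120 := ⟨_, hst.symm⟩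
  have hg := Nat.dvd_gcd hcd hd
  rcases hplist with ⟨rfl, he⟩ | ⟨rfl, he⟩ | rfl | rfl | rfl | rfl | rfl
  · exact hfree (by norm_num) he
  · exact hfree (by norm_num) he
  · have := Nat.le_of_dvd (by norm_num) hg; norm_num at this; omega
  · have h12 : (S.orb 1).card ∣ 12 := hd
    have hle12 := Nat.le_of_dvd (by norm_num) h12
    have hcase : (S.orb 1).card = 6 ∨ (S.orb 1).card = 12 := by
      clear hg hd hcd
      generalize (S.orb 1).card = k at *
      interval_cases k <;> omega
    rcases hcase with hc | hc
    · exact S.six_orbit h hc c13a c13b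
    · have hu : S.orb 1 = Finset.univ.erase 0 := by
        apply Finset.eq_of_subset_of_card_le
        · intro x hx
          exact Finset.mem_erase.mpr ⟨S.orb_one_ne hx, Finset.mem_univ _⟩
        · rw [hc, Finset.card_erase_of_mem (Finset.mem_univ _), Finset.card_univ, ZMod.card]
      have ht : S.Trans := by
        intro x y hx hy
        have h1 : ∀ z : ZMod 13, z ≠ 0 → z ∈ S.orb 1 := fun z hz => by
          rw [hu]; exact Finset.mem_erase.mpr ⟨hz, Finset.mem_univ _⟩
        rw [S.orb_eq (h1 x hx)]; exact h1 y hy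
      have := (S.kill_all ht h (one_ne_zero (α := ZMod 13))).1 (by omega)
      rw [hc] at hst
      omega
  · have := Nat.le_of_dvd (by norm_num) hg; norm_num at this; omega
  · have := Nat.le_of_dvd (by norm_num) hg; norm_num at this; omega
  · have h6 : (S.orb 1).card ∣ 6 := hg
    have hle6 := Nat.le_of_dvd (by norm_num) h6
    have hcase : (S.orb 1).card = 6 := by
      clear hg hd hcd
      generalize (S.orb 1).card = k at *
      interval_cases k <;> omega
    exact S.six_orbit h hcase c19a c19b

end SkewData

open Equiv.Perm

set_option linter.unusedSectionVars false
set_option linter.unusedDecidableInType false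

namespace Six

/-- Translation by one. -/
def T : Equiv.Perm (ZMod 6) := Equiv.addLeft 1
/-- Coxeter generators. -/
def t1 : Equiv.Perm (ZMod 6) := Equiv.swap 1 2
/-- Coxeter generators. -/
def t2 : Equiv.Perm (ZMod 6) := Equiv.swap 2 3
/-- Coxeter generators. -/
def t3 : Equiv.Perm (ZMod 6) := Equiv.swap 3 4
/-- Coxeter generators. -/
def t4 : Equiv.Perm (ZMod 6) := Equiv.swap 4 5

theorem check : ∀ u : Equiv.Perm (ZMod 6), u * u = 1 →
    u * (T * (T * u * T⁻¹) * T⁻¹) = (T * (T * u * T⁻¹) * T⁻¹) * u →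
    u * (T * (T * (T * u * T⁻¹) * T⁻¹) * T⁻¹) = (T * (T * (T * u * T⁻¹) * T⁻¹) * T⁻¹) * u →
    (u * (T * u * T⁻¹)) ^ 3 = 1 →
    u = T * u * T⁻¹ ∨ ∃ x, u x = x ∧ (T * u * T⁻¹) x = x ∧ (T * (T * u * T⁻¹) * T⁻¹) x = x ∧
      (T * (T * (T * u * T⁻¹) * T⁻¹) * T⁻¹) x = x := by
  decide +kernel

theorem card_stab0 : Fintype.card {σ : Equiv.Perm (ZMod 6) // σ 0 = 0} = 120 := by
  decide +kernel

theorem s1 : ∀ x, t2 (1 + x) - 1 = t1 x := by decide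
theorem s2 : ∀ x, t3 (1 + x) - 1 = t2 x := by decide
theorem s3 : ∀ x, t4 (1 + x) - 1 = t3 x := by decide

end Six

open Six in
theorem six_extend (R : SkewData S5 (ZMod 6)) (h : ¬ R.Triv) (χ : S5 → ZMod 6 → ZMod 6)
    (χ_one : ∀ x, χ 1 x = x) (χ_mul : ∀ a b x, χ (a * b) x = χ b (χ a x))
    (χ_add : ∀ b v x, χ b (v + x) = R.ps b v + χ (R.pw v b) x) :
    ∃ x, ∀ a ∈ A5, χ a x = x := by
  have hinj : Function.Injective R.act := by
    rw [injective_iff_map_eq_one]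
    intro b hb
    have : b⁻¹ = 1 := by
      apply R.faithful h
      intro i
      rw [← R.act_apply, hb]; rfl
    exact inv_eq_one.mp this
  have hsurj : ∀ σ : Equiv.Perm (ZMod 6), σ 0 = 0 → ∃ b, R.act b = σ := by
    let f : S5 → {σ : Equiv.Perm (ZMod 6) // σ 0 = 0} :=
      fun b => ⟨R.act b, by rw [R.act_apply, R.ps_zero]⟩
    have hf : Function.Bijective f := by
      rw [Fintype.bijective_iff_injective_and_card]
      refine ⟨fun a b hab => hinj (congrArg Subtype.val hab), ?_⟩
      rw [card_stab0, S5.card_eq]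
    intro σ hσ
    obtain ⟨b, hb⟩ := hf.2 ⟨σ, hσ⟩
    exact ⟨b, congrArg Subtype.val hb⟩
  let X : S5 →* Equiv.Perm (ZMod 6) :=
    { toFun := fun b => ⟨χ b⁻¹, χ b, fun x => by rw [← χ_mul, inv_mul_cancel, χ_one],
        fun x => by rw [← χ_mul, mul_inv_cancel, χ_one]⟩
      map_one' := by ext1 x; change χ 1⁻¹ x = x; rw [inv_one, χ_one]
      map_mul' := by
        intro a b; ext1 x
        change χ (a * b)⁻¹ x = χ a⁻¹ (χ b⁻¹ x)
        rw [mul_inv_rev, χ_mul] }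
  have hX : ∀ b x, X b x = χ b⁻¹ x := fun b x => rfl
  obtain ⟨b1, h1⟩ := hsurj t1 (by decide)
  obtain ⟨b2, h2⟩ := hsurj t2 (by decide)
  obtain ⟨b3, h3⟩ := hsurj t3 (by decide)
  obtain ⟨b4, h4⟩ := hsurj t4 (by decide)
  have i1 : b1 * b1 = 1 := hinj (by rw [map_mul, h1, map_one]; decide)
  have i2 : b2 * b2 = 1 := hinj (by rw [map_mul, h2, map_one]; decide)
  have i3 : b3 * b3 = 1 := hinj (by rw [map_mul, h3, map_one]; decide)
  have i4 : b4 * b4 = 1 := hinj (by rw [map_mul, h4, map_one]; decide)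
  have step : ∀ b c : S5, b * b = 1 → c * c = 1 → R.act c 1 = 1 →
      (∀ x, R.act c (1 + x) - 1 = R.act b x) → X c = T * X b * T⁻¹ := by
    intro b c hb hc hc1 hbc
    have hbi : b⁻¹ = b := inv_eq_of_mul_eq_one_left hb
    have hci : c⁻¹ = c := inv_eq_of_mul_eq_one_left hc
    rw [R.act_apply, hci] at hc1
    have hpw : R.pw 1 c = b := by
      rw [← mul_inv_eq_one]
      apply R.faithful h
      intro i
      rw [R.ps_mul]
      have e := hbc i
      rw [R.act_apply, R.act_apply, hci, hbi] at e
      have : R.ps (R.pw 1 c) i = R.ps b i := by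
        have e2 := R.ps_add c 1 i
        rw [hc1] at e2
        rw [← e, e2, add_sub_cancel_left]
      rw [this, R.ps_inv_ps]
    rw [eq_mul_inv_iff_mul_eq]
    ext1 x
    rw [Equiv.Perm.mul_apply, Equiv.Perm.mul_apply, hX, hX, hbi, hci]
    change χ c (1 + x) = 1 + χ b x
    rw [χ_add, hc1, hpw]
  have e2 : X b2 = T * X b1 * T⁻¹ := step b1 b2 i1 i2 (by rw [h2]; decide) (by rw [h1, h2]; exact s1)
  have e3 : X b3 = T * X b2 * T⁻¹ := step b2 b3 i2 i3 (by rw [h3]; decide) (by rw [h2, h3]; exact s2)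
  have e4 : X b4 = T * X b3 * T⁻¹ := step b3 b4 i3 i4 (by rw [h4]; decide) (by rw [h3, h4]; exact s3)
  have r3 : b1 * b3 = b3 * b1 := hinj (by rw [map_mul, map_mul, h1, h3]; decide)
  have r4 : b1 * b4 = b4 * b1 := hinj (by rw [map_mul, map_mul, h1, h4]; decide)
  have r2 : (b1 * b2) ^ 3 = 1 := hinj (by rw [map_pow, map_mul, h1, h2, map_one]; decide)
  have c1 : X b1 * X b1 = 1 := by rw [← map_mul, i1, map_one]
  have c3 : X b1 * X b3 = X b3 * X b1 := by rw [← map_mul, r3, map_mul]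
  have c4 : X b1 * X b4 = X b4 * X b1 := by rw [← map_mul, r4, map_mul]
  have c2 : (X b1 * X b2) ^ 3 = 1 := by rw [← map_mul, ← map_pow, r2, map_one]
  have hch := check (X b1) c1 (by rw [← e2, ← e3]; exact c3) (by rw [← e2, ← e3, ← e4]; exact c4)
    (by rw [← e2]; exact c2)
  rw [← e2, ← e3, ← e4] at hch
  rcases hch with he | ⟨x, x1, x2, x3, x4⟩
  · have hker : b1 * b2⁻¹ ∈ X.ker := by
      rw [MonoidHom.mem_ker, map_mul, map_inv, he, mul_inv_cancel]
    have hne : X.ker ≠ ⊥ := by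
      intro hb
      rw [hb, Subgroup.mem_bot, mul_inv_eq_one] at hker
      rw [hker, h2] at h1
      exact absurd h1 (by decide)
    have hle := S5.normal_ge X.ker inferInstance hne
    refine ⟨0, fun a ha => ?_⟩
    have h5 : X a⁻¹ = 1 := hle (A5.inv_mem ha)
    have h6 := hX a⁻¹ 0
    rw [h5, inv_inv] at h6
    exact h6.symm
  · let H : Subgroup S5 := (MulAction.stabilizer (Equiv.Perm (ZMod 6)) x).comap X
    have hH : ∀ b, b ∈ H ↔ X b x = x := fun b => Iff.rfl
    have m1 : b1 ∈ H := (hH _).mpr x1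
    have m2 : b2 ∈ H := (hH _).mpr x2
    have m3 : b3 ∈ H := (hH _).mpr x3
    have m4 : b4 ∈ H := (hH _).mpr x4
    have hord : ∀ b ∈ H, orderOf (R.act b) ∣ Nat.card H := by
      intro b hb
      rw [orderOf_injective R.act hinj, ← Subgroup.orderOf_mk b hb]
      exact orderOf_dvd_natCard _
    have o3 : 3 ∣ Nat.card H := by
      have := hord _ (H.mul_mem m1 m2)
      rw [map_mul, h1, h2, orderOf_eq_prime (p := 3) (by decide) (by decide)] at this
      exact this
    have o5 : 5 ∣ Nat.card H := by
      have : Fact (Nat.Prime 5) := ⟨by norm_num⟩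
      have := hord _ (H.mul_mem (H.mul_mem (H.mul_mem m1 m2) m3) m4)
      rw [map_mul, map_mul, map_mul, h1, h2, h3, h4,
        orderOf_eq_prime (p := 5) (by decide +kernel) (by decide +kernel)] at this
      exact this
    have o4 : 4 ∣ Nat.card H := by
      have := hord _ (H.mul_mem (H.mul_mem m1 m2) m3)
      rw [map_mul, map_mul, h1, h2, h3,
        orderOf_eq_prime_pow (p := 2) (n := 1) (by decide) (by decide)] at this
      exact this
    have hidx := H.card_mul_index
    rw [Nat.card_eq_fintype_card (α := S5), S5.card_eq] at hidx
    have h60 : 60 ∣ Nat.card H := by omega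
    obtain ⟨k, hk⟩ := h60
    rw [hk] at hidx
    have hki : k * H.index = 2 := by
      have : 60 * (k * H.index) = 60 * 2 := by rw [← mul_assoc, hidx]
      omega
    have hile : H.index = 1 ∨ H.index = 2 :=
      (Nat.dvd_prime Nat.prime_two).mp ⟨k, by rw [mul_comm]; exact hki.symm⟩
    have hle : A5 ≤ H := by
      rcases hile with hi | hi
      · rw [Subgroup.index_eq_one.mp hi]; exact le_top
      · refine S5.normal_ge H (Subgroup.normal_of_index_eq_two hi) ?_
        intro hb
        rw [hb, Subgroup.mem_bot] at m1
        rw [m1, map_one] at h1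
        exact absurd h1 (by decide)
    refine ⟨x, fun a ha => ?_⟩
    have h5 := (hH _).mp (hle (A5.inv_mem ha))
    rwa [hX, inv_inv] at h5

open Equiv.Perm

set_option linter.unusedSectionVars false
set_option linter.unusedDecidableInType false

theorem prim_card {A : Type*} [AddCommGroup A] [Fintype A] [hA : IsAddCyclic A]
    (R : SkewData S5 A) (hP : R.Prim) (h : ¬ R.Triv) : Fintype.card A = 6 := by
  classical
  by_cases hp : (Fintype.card A).Prime
  · exfalso
    rw [← Nat.card_eq_fintype_card] at hp
    have : Fact (Nat.card A).Prime := ⟨hp⟩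
    let e := zmodAddCyclicAddEquiv hA
    refine (R.transport e).prime_case ?_
    intro ht
    apply h
    intro a ha i
    have h1 : e.symm (R.ps a (e (e.symm i))) = e.symm i := ht a ha (e.symm i)
    rw [e.apply_symm_apply] at h1
    exact e.symm.injective h1
  · exact R.composite hP h hp

theorem main_six (n : ℕ) [NeZero n] (S : SkewData S5 (ZMod n)) (h : ¬ S.Triv) : n = 6 := by
  classical
  have hex : ∃ D : AddSubgroup (ZMod n), S.Inv D ∧ D ≠ ⊥ := by
    refine ⟨⊤, fun _ _ _ => trivial, ?_⟩
    intro hbot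
    apply h
    intro a _ i
    have : i ∈ (⊤ : AddSubgroup (ZMod n)) := trivial
    rw [hbot, AddSubgroup.mem_bot] at this
    rw [this, S.ps_zero]
  obtain ⟨D, ⟨hD, hDne⟩, hmin⟩ := exists_minimal_of_wellFoundedLT _ hex
  let R := S.restrict D hD
  have hRps : ∀ b (d : D), ((R.ps b d : D) : ZMod n) = S.ps b d := fun b d => rfl
  have hRpw : ∀ b (d : D), R.pw d b = S.pw d b := fun b d => rfl
  have hRT : ¬ R.Triv := by
    intro ht
    apply h
    apply S.triv_of_fixed D hD hDne
    intro a ha d hd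
    exact congrArg Subtype.val (ht a ha ⟨d, hd⟩)
  have hRP : R.Prim := by
    intro E hE
    by_cases hEb : E = ⊥
    · exact Or.inl hEb
    right
    have hle : D ≤ E.map D.subtype := by
      apply hmin
      · constructor
        · intro b d hd
          obtain ⟨x, hx, rfl⟩ := AddSubgroup.mem_map.mp hd
          exact AddSubgroup.mem_map.mpr ⟨R.ps b x, hE b x hx, rfl⟩
        · intro hb
          apply hEb
          rw [AddSubgroup.eq_bot_iff_forall]
          intro x hx
          have : D.subtype x ∈ E.map D.subtype := AddSubgroup.mem_map_of_mem _ hx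
          rw [hb, AddSubgroup.mem_bot] at this
          exact Subtype.ext this
      · intro y hy
        obtain ⟨x, hx, rfl⟩ := AddSubgroup.mem_map.mp hy
        exact x.2
    rw [AddSubgroup.eq_top_iff']
    intro x
    obtain ⟨y, hy, hyx⟩ := AddSubgroup.mem_map.mp (hle x.2)
    have : y = x := Subtype.ext hyx
    rwa [← this]
  have hc6 : Fintype.card D = 6 := prim_card R hRP hRT
  by_cases htop : D = ⊤
  · have : Nat.card D = n := by rw [htop, AddSubgroup.card_top, Nat.card_zmod]
    rw [← this, Nat.card_eq_fintype_card, hc6]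
  exfalso
  have hg : ∃ g0, g0 ∉ D := by
    by_contra hall
    push Not at hall
    exact htop ((AddSubgroup.eq_top_iff' D).mpr hall)
  obtain ⟨g0, hg0⟩ := hg
  have hA5 := S.A5_le_modKer D hD hDne
  have hM : ∀ b i, S.ps b i - i ∈ D := by
    by_contra hno
    push Not at hno
    obtain ⟨b0, i0, hb0⟩ := hno
    have hsub : ∀ c ∈ S.modKer D hD, c ∈ A5 := by
      intro c hc
      by_contra hcA
      apply hb0
      have hb0A : b0 ∉ A5 := fun hm => hb0 (hA5 b0 hm i0)
      rw [mem_alternatingGroup] at hcA hb0A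
      have s1 := (Int.units_eq_one_or _).resolve_left hcA
      have s2 := (Int.units_eq_one_or _).resolve_left hb0A
      have h1 : b0 * c⁻¹ ∈ A5 := by
        rw [mem_alternatingGroup, map_mul, sign_inv, s1, s2]; decide
      have h2 : b0 * c⁻¹ ∈ S.modKer D hD := hA5 _ h1
      have h3 := (S.modKer D hD).mul_mem h2 hc
      rw [inv_mul_cancel_right] at h3
      exact h3 i0
    obtain ⟨g, hgs⟩ := exists_odd_add (A := D) hc6 odd6
    have := R.parity hRP hgs (by
      intro v b
      have h1 := hsub _ (S.inv_mul_pw_mem D hD v v.2 b)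
      have h2 := R.sign_act_A5 h1
      rw [map_mul, map_mul, map_inv, sign_inv] at h2
      have h3 := eq_inv_of_mul_eq_one_right h2
      rw [Int.units_inv_eq_self] at h3
      exact h3)
    omega
  have hcyc : IsAddCyclic D := inferInstance
  have hn6 : Nat.card D = 6 := by rw [Nat.card_eq_fintype_card, hc6]
  let e : ZMod 6 ≃+ D := hn6 ▸ zmodAddCyclicAddEquiv hcyc
  have hmem : ∀ b (x : ZMod 6), S.ps b (g0 + e x) - g0 ∈ D := by
    intro b x
    have := D.add_mem (hM b (g0 + e x)) (e x).2
    convert this using 1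
    abel
  let χ : S5 → ZMod 6 → ZMod 6 := fun b x => e.symm ⟨S.ps b (g0 + e x) - g0, hmem b x⟩
  have hχ : ∀ b x, ((e (χ b x) : D) : ZMod n) = S.ps b (g0 + e x) - g0 := by
    intro b x
    simp [χ]
  have hext : ∀ x y : ZMod 6, ((e x : D) : ZMod n) = e y → x = y :=
    fun x y hxy => e.injective (Subtype.ext hxy)
  have hRT' : ¬ (R.transport e).Triv := by
    intro ht
    apply hRT
    intro a ha i
    have h1 : e.symm (R.ps a (e (e.symm i))) = e.symm i := ht a ha (e.symm i)
    rw [e.apply_symm_apply] at h1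
    exact e.symm.injective h1
  have hR'ps : ∀ b x, ((e ((R.transport e).ps b x) : D) : ZMod n) = S.ps b (e x) := by
    intro b x
    change ((e (e.symm (R.ps b (e x))) : D) : ZMod n) = _
    rw [e.apply_symm_apply, hRps]
  have hR'pw : ∀ b x, (R.transport e).pw x b = S.pw (e x) b := fun b x => rfl
  obtain ⟨x, hx⟩ := six_extend (R.transport e) hRT' χ
    (by intro x; apply hext; rw [hχ, S.ps_one]; abel)
    (by
      intro a b x; apply hext
      rw [hχ, hχ, hχ, S.ps_mul, add_sub_cancel])
    (by
      intro b v x; apply hext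
      rw [hχ, map_add, map_add, AddSubgroup.coe_add, AddSubgroup.coe_add, hR'ps, hχ, hR'pw,
        ← add_assoc, add_comm g0, add_assoc, S.ps_add]
      abel)
  have hfix : g0 + e x ∈ S.fixA := by
    intro a ha
    have h1 := hχ a x
    rw [hx a ha, eq_sub_iff_add_eq] at h1
    exact h1.symm.trans (add_comm _ _)
  apply h
  apply S.triv_of_fixed S.fixA S.fixA_inv
  · intro hb
    rw [hb, AddSubgroup.mem_bot] at hfix
    apply hg0
    rw [eq_neg_of_add_eq_zero_left hfix]
    exact D.neg_mem (e x).2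
  · intro a ha d hd
    exact hd a ha

/-- `Sym(5)` has exactly `214` proper skew morphisms. -/
theorem stmt_17 :
    Nat.card {φ : Equiv.Perm (Fin 5) → Equiv.Perm (Fin 5) //
      IsProperSkewMorphism φ} = 214 := by
  exact final_count main_six
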